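/- arXiv:1902.00832 — 3 statements merged into one kernel-verified Lean document; each statement's English description precedes it below -/
import Mathlib

section
/- Let (Ω, 𝒫) be a probability space and T : Ω → ℝ^d a measurable map with E[T] = 0, E[T·Tᵀ] = I (the d×d identity matrix), and ‖T(η)‖₂ ≤ √L for 𝒫-almost every η. Let 0 < δ ≤ min{m², 1}/(2^18 · d · (L+1)³). For each η ∈ Ω the map F_η(y) := y − δ∇U(y) + √(2δ)·T(η) is a bijection of ℝ^d. Set p*(x) := exp(−U(x)) and p_δ(x) := E_η[ p*(F_η^{-1}(x)) · det(I − δ∇²U(F_η^{-1}(x)))^{-1} ]. Then for every x ∈ ℝ^d, |p_δ(x)/p*(x) − 1| ≤ 512 · δ^{3/2} · d · (L+1)^{9/2} · exp((m/32)·‖x‖₂²) · (‖x‖₂⁶ + 1). -/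
open MeasureTheory

/-- The Hessian matrix of `U : ℝ^d → ℝ` at `x`. -/
noncomputable def hessMat {d : ℕ} (U : EuclideanSpace ℝ (Fin d) → ℝ)
    (x : EuclideanSpace ℝ (Fin d)) : Matrix (Fin d) (Fin d) ℝ :=
  fun i j =>
    iteratedFDeriv ℝ 2 U x ![EuclideanSpace.single i 1, EuclideanSpace.single j 1]

section calc_lemmas
set_option linter.unusedSectionVars false
variable {E : Type*} [NormedAddCommGroup E] [InnerProductSpace ℝ E] [CompleteSpace E]

theorem aux_symm {U : E → ℝ} (hU : ContDiff ℝ 3 U) (x u v : E) :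
    fderiv ℝ (fderiv ℝ U) x u v = fderiv ℝ (fderiv ℝ U) x v u := by
  have h : IsSymmSndFDerivAt ℝ U x :=
    (hU.contDiffAt).isSymmSndFDerivAt (by simp; norm_cast)
  exact h u v

theorem aux_D2_norm {U : E → ℝ} (hU : ContDiff ℝ 3 U) {m L : ℝ} (hm : 0 < m) (hmL : m ≤ L)
    (hLB : ∀ x v, m * ‖v‖ ^ 2 ≤ iteratedFDeriv ℝ 2 U x ![v, v])
    (hUB : ∀ x v, iteratedFDeriv ℝ 2 U x ![v, v] ≤ L * ‖v‖ ^ 2) (x : E) :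
    ‖fderiv ℝ (fderiv ℝ U) x‖ ≤ L := by
  have hL : 0 < L := lt_of_lt_of_le hm hmL
  refine ContinuousLinearMap.opNorm_le_bound₂ _ hL.le fun u v => ?_
  have e : ∀ v, iteratedFDeriv ℝ 2 U x ![v, v] = fderiv ℝ (fderiv ℝ U) x v v := by
    intro v; rw [iteratedFDeriv_two_apply]; simp
  set B := fderiv ℝ (fderiv ℝ U) x with hB
  have hpos : ∀ v, 0 ≤ B v v := fun v => by
    rw [← e]; exact le_trans (by positivity) (hLB x v)
  let B' : LinearMap.BilinForm ℝ E := LinearMap.mk₂ ℝ (fun u v => B u v)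
    (by intros; simp) (by intros; simp) (by intros; simp) (by intros; simp)
  have key := B'.apply_sq_le_of_symm (fun v => hpos v) ⟨fun u v => aux_symm hU x u v⟩ u v
  have key : (B u v) ^ 2 ≤ B u u * B v v := key
  have h1 : B u u ≤ L * ‖u‖ ^ 2 := by rw [← e]; exact hUB x u
  have h2 : B v v ≤ L * ‖v‖ ^ 2 := by rw [← e]; exact hUB x v
  rw [Real.norm_eq_abs]
  apply abs_le_of_sq_le_sq _ (by positivity)
  calc (B u v) ^ 2 ≤ B u u * B v v := key
    _ ≤ (L * ‖u‖ ^ 2) * (L * ‖v‖ ^ 2) := mul_le_mul h1 h2 (hpos v) (by positivity)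
    _ = _ := by ring

theorem aux_diff1 {U : E → ℝ} (hU : ContDiff ℝ 3 U) : Differentiable ℝ U :=
  hU.differentiable (by norm_num)

theorem aux_cd1 {U : E → ℝ} (hU : ContDiff ℝ 3 U) : ContDiff ℝ 2 (fderiv ℝ U) :=
  hU.fderiv_right (by norm_num)

theorem aux_cd2 {U : E → ℝ} (hU : ContDiff ℝ 3 U) : ContDiff ℝ 1 (fderiv ℝ (fderiv ℝ U)) :=
  (aux_cd1 hU).fderiv_right (by norm_num)

theorem aux_lip1 {U : E → ℝ} (hU : ContDiff ℝ 3 U) {L : ℝ}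
    (h2 : ∀ x, ‖fderiv ℝ (fderiv ℝ U) x‖ ≤ L) (x y : E) :
    ‖fderiv ℝ U y - fderiv ℝ U x‖ ≤ L * ‖y - x‖ :=
  Convex.norm_image_sub_le_of_norm_fderiv_le (𝕜 := ℝ)
    (fun z _ => ((aux_cd1 hU).differentiable (by norm_num)) z) (fun z _ => h2 z) convex_univ
    (Set.mem_univ _) (Set.mem_univ _)

theorem aux_lip2 {U : E → ℝ} (hU : ContDiff ℝ 3 U) {L : ℝ}
    (h3 : ∀ x, ‖iteratedFDeriv ℝ 3 U x‖ ≤ L) (x y : E) :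
    ‖fderiv ℝ (fderiv ℝ U) y - fderiv ℝ (fderiv ℝ U) x‖ ≤ L * ‖y - x‖ := by
  refine Convex.norm_image_sub_le_of_norm_fderiv_le (𝕜 := ℝ)
    (fun z _ => ((aux_cd2 hU).differentiable (by norm_num)) z) (fun z _ => ?_) convex_univ
    (Set.mem_univ _) (Set.mem_univ _)
  rw [← norm_iteratedFDeriv_one, norm_iteratedFDeriv_fderiv, norm_iteratedFDeriv_fderiv]
  exact h3 z

theorem aux_grad_lip {U : E → ℝ} (hU : ContDiff ℝ 3 U) {L : ℝ}
    (h2 : ∀ x, ‖fderiv ℝ (fderiv ℝ U) x‖ ≤ L) (x y : E) :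
    ‖gradient U y - gradient U x‖ ≤ L * ‖y - x‖ := by
  unfold gradient
  rw [← map_sub, LinearIsometryEquiv.norm_map]
  exact aux_lip1 hU h2 x y

theorem aux_taylor1 {U : E → ℝ} (hU : ContDiff ℝ 3 U) {L : ℝ} (hL : 0 ≤ L)
    (h2 : ∀ x, ‖fderiv ℝ (fderiv ℝ U) x‖ ≤ L) (x y : E) :
    |U y - U x - fderiv ℝ U x (y - x)| ≤ L * ‖y - x‖ ^ 2 := by
  have := Convex.norm_image_sub_le_of_norm_hasFDerivWithin_le (𝕜 := ℝ)
    (f := fun z => U z - fderiv ℝ U x z) (f' := fun z => fderiv ℝ U z - fderiv ℝ U x)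
    (s := Metric.closedBall x ‖y - x‖) (C := L * ‖y - x‖) (x := x) (y := y)
    (fun z _ => (((aux_diff1 hU z).hasFDerivAt).sub
      (fderiv ℝ U x).hasFDerivAt).hasFDerivWithinAt)
    (fun z hz => (aux_lip1 hU h2 x z).trans (by
      rw [mem_closedBall_iff_norm] at hz; gcongr))
    (convex_closedBall _ _) (by simp) (by rw [mem_closedBall_iff_norm])
  rw [Real.norm_eq_abs] at this
  convert this using 1
  · rw [map_sub]; congr 1; ring
  · ring

theorem aux_taylor2g {U : E → ℝ} (hU : ContDiff ℝ 3 U) {L : ℝ} (hL : 0 ≤ L)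
    (h3 : ∀ x, ‖iteratedFDeriv ℝ 3 U x‖ ≤ L) (x y : E) :
    ‖fderiv ℝ U y - fderiv ℝ U x - fderiv ℝ (fderiv ℝ U) x (y - x)‖ ≤ L * ‖y - x‖ ^ 2 := by
  have := Convex.norm_image_sub_le_of_norm_hasFDerivWithin_le (𝕜 := ℝ)
    (f := fun z => fderiv ℝ U z - fderiv ℝ (fderiv ℝ U) x z)
    (f' := fun z => fderiv ℝ (fderiv ℝ U) z - fderiv ℝ (fderiv ℝ U) x)
    (s := Metric.closedBall x ‖y - x‖) (C := L * ‖y - x‖) (x := x) (y := y)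
    (fun z _ => ((((aux_cd1 hU).differentiable (by norm_num) z).hasFDerivAt).sub
      (fderiv ℝ (fderiv ℝ U) x).hasFDerivAt).hasFDerivWithinAt)
    (fun z hz => (aux_lip2 hU h3 x z).trans (by
      rw [mem_closedBall_iff_norm] at hz; gcongr))
    (convex_closedBall _ _) (by simp) (by rw [mem_closedBall_iff_norm])
  convert this using 1
  · rw [map_sub]; congr 1; abel
  · ring

theorem aux_taylor2 {U : E → ℝ} (hU : ContDiff ℝ 3 U) {L : ℝ} (hL : 0 ≤ L)
    (h3 : ∀ x, ‖iteratedFDeriv ℝ 3 U x‖ ≤ L) (x y : E) :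
    |U y - U x - fderiv ℝ U x (y - x) - 1 / 2 * fderiv ℝ (fderiv ℝ U) x (y - x) (y - x)|
      ≤ L * ‖y - x‖ ^ 3 := by
  set B := fderiv ℝ (fderiv ℝ U) x with hB
  have hd : ∀ z, HasFDerivAt
      (fun z => U z - fderiv ℝ U x z - (1 / 2 : ℝ) * B (z - x) (z - x))
      (fderiv ℝ U z - fderiv ℝ U x - B (z - x)) z := by
    intro z
    have h1 : HasFDerivAt (fun z => z - x) (ContinuousLinearMap.id ℝ E) z :=
      (hasFDerivAt_id z).sub_const x
    have h2 : HasFDerivAt (fun z => B (z - x)) B z := by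
      have h := (B.hasFDerivAt (x := z - x)).comp z h1
      rw [ContinuousLinearMap.comp_id] at h
      exact h
    have h3 := (h2.clm_apply h1).const_mul (1 / 2 : ℝ)
    have h4 := (((aux_diff1 hU z).hasFDerivAt).sub (fderiv ℝ U x).hasFDerivAt).sub h3
    refine h4.congr_fderiv ?_
    ext v
    simp only [sub_apply, smul_apply,
      add_apply, ContinuousLinearMap.comp_apply,
      ContinuousLinearMap.flip_apply, ContinuousLinearMap.id_apply, smul_eq_mul]
    have := aux_symm hU x v (z - x)
    rw [← hB] at this
    rw [this]; ring
  have := Convex.norm_image_sub_le_of_norm_hasFDerivWithin_le (𝕜 := ℝ)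
    (s := Metric.closedBall x ‖y - x‖) (C := L * ‖y - x‖ ^ 2) (x := x) (y := y)
    (fun z _ => (hd z).hasFDerivWithinAt)
    (fun z hz => (aux_taylor2g hU hL h3 x z).trans (by
      rw [mem_closedBall_iff_norm] at hz; gcongr))
    (convex_closedBall _ _) (by simp) (by rw [mem_closedBall_iff_norm])
  rw [Real.norm_eq_abs] at this
  convert this using 1
  · rw [map_sub (fderiv ℝ U x)]; congr 1; simp; ring
  · ring

theorem aux_exp (z : ℝ) : |Real.exp z - 1 - z - z ^ 2 / 2| ≤ |z| ^ 3 * Real.exp |z| := by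
  have := Complex.norm_exp_sub_sum_le_norm_mul_exp (z : ℂ) 3
  simp only [Finset.sum_range_succ, Finset.sum_range_zero, Complex.norm_real,
    Real.norm_eq_abs] at this
  rw [← Real.norm_eq_abs (Real.exp z - 1 - z - z ^ 2 / 2), ← Complex.norm_real]
  convert this using 2
  push_cast
  simp [Nat.factorial]; ring

end calc_lemmas

section matrix_lemmas
variable {d : ℕ}

theorem aux_hess_apply (U : EuclideanSpace ℝ (Fin d) → ℝ) (x : EuclideanSpace ℝ (Fin d))
    (i j : Fin d) : hessMat U x i j = fderiv ℝ (fderiv ℝ U) x (EuclideanSpace.single i 1)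
      (EuclideanSpace.single j 1) := by
  unfold hessMat; rw [iteratedFDeriv_two_apply]; simp

theorem aux_bilin_expand (B : EuclideanSpace ℝ (Fin d) →L[ℝ] EuclideanSpace ℝ (Fin d) →L[ℝ] ℝ)
    (u v : EuclideanSpace ℝ (Fin d)) :
    B u v = ∑ i, ∑ j, B (EuclideanSpace.single i 1) (EuclideanSpace.single j 1) * (u i * v j) := by
  have hu : ∀ u : EuclideanSpace ℝ (Fin d), u = ∑ i, u i • EuclideanSpace.single i (1 : ℝ) := by
    intro u
    have := (EuclideanSpace.basisFun (Fin d) ℝ).sum_repr u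
    simpa using this.symm
  conv_lhs => rw [hu u, hu v]
  simp only [map_sum, map_smul, sum_apply, smul_apply, smul_eq_mul,
    Finset.mul_sum]
  rw [Finset.sum_comm]
  refine Finset.sum_congr rfl fun i _ => Finset.sum_congr rfl fun j _ => ?_
  ring

theorem aux_hess_trace (U : EuclideanSpace ℝ (Fin d) → ℝ) (x : EuclideanSpace ℝ (Fin d)) :
    (hessMat U x).trace = ∑ i, fderiv ℝ (fderiv ℝ U) x (EuclideanSpace.single i 1)
      (EuclideanSpace.single i 1) := by
  simp [Matrix.trace, aux_hess_apply]

theorem aux_trace_diff {U : EuclideanSpace ℝ (Fin d) → ℝ} (hU : ContDiff ℝ 3 U) {L : ℝ}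
    (h3 : ∀ x, ‖iteratedFDeriv ℝ 3 U x‖ ≤ L) (x y : EuclideanSpace ℝ (Fin d)) :
    |(hessMat U y).trace - (hessMat U x).trace| ≤ d * (L * ‖y - x‖) := by
  rw [aux_hess_trace, aux_hess_trace, ← Finset.sum_sub_distrib]
  refine (Finset.abs_sum_le_sum_abs _ _).trans ?_
  calc _ ≤ ∑ i : Fin d, L * ‖y - x‖ := by
        refine Finset.sum_le_sum fun i _ => ?_
        have := (fderiv ℝ (fderiv ℝ U) y - fderiv ℝ (fderiv ℝ U) x).le_opNorm₂
          (EuclideanSpace.single i 1) (EuclideanSpace.single i 1)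
        simp only [sub_apply, PiLp.norm_single, norm_one, mul_one, Real.norm_eq_abs] at this
        exact this.trans (aux_lip2 hU h3 x y)
    _ = _ := by simp

theorem aux_trace_bound {U : EuclideanSpace ℝ (Fin d) → ℝ} {L : ℝ}
    (h2 : ∀ x, ‖fderiv ℝ (fderiv ℝ U) x‖ ≤ L) (x : EuclideanSpace ℝ (Fin d)) :
    |(hessMat U x).trace| ≤ d * L := by
  rw [aux_hess_trace]
  refine (Finset.abs_sum_le_sum_abs _ _).trans ?_
  calc _ ≤ ∑ i : Fin d, L := by
        refine Finset.sum_le_sum fun i _ => ?_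
        have := (fderiv ℝ (fderiv ℝ U) x).le_opNorm₂
          (EuclideanSpace.single i 1) (EuclideanSpace.single i 1)
        simp only [PiLp.norm_single, norm_one, mul_one, Real.norm_eq_abs] at this
        exact this.trans (h2 x)
    _ = _ := by simp

theorem aux_det {U : EuclideanSpace ℝ (Fin d) → ℝ} (hU : ContDiff ℝ 3 U) {m L : ℝ}
    (hm : 0 < m) (hmL : m ≤ L)
    (hLB : ∀ x v, m * ‖v‖ ^ 2 ≤ iteratedFDeriv ℝ 2 U x ![v, v])
    (hUB : ∀ x v, iteratedFDeriv ℝ 2 U x ![v, v] ≤ L * ‖v‖ ^ 2)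
    {δ : ℝ} (hδ : 0 < δ) (hδL : δ * L ≤ 1 / 2) (y : EuclideanSpace ℝ (Fin d)) :
    0 < (1 - δ • hessMat U y).det ∧
    |- Real.log (1 - δ • hessMat U y).det - δ * (hessMat U y).trace| ≤ d * (2 * (δ * L) ^ 2) := by
  have hL : 0 < L := lt_of_lt_of_le hm hmL
  have hsym : (1 - δ • hessMat U y).IsHermitian := by
    ext i j
    simp only [Matrix.conjTranspose_apply, Matrix.sub_apply, Matrix.smul_apply, star_trivial,
      smul_eq_mul, Matrix.one_apply, aux_hess_apply]
    rw [aux_symm hU y (EuclideanSpace.single j 1)]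
    simp [eq_comm]
  have hev : ∀ i, 1 - δ * L ≤ hsym.eigenvalues i ∧ hsym.eigenvalues i ≤ 1 := by
    intro i
    set v := hsym.eigenvectorBasis i with hv
    have hvn : ‖v‖ = 1 := hsym.eigenvectorBasis.orthonormal.1 i
    have e1 : hsym.eigenvalues i = ∑ a, ∑ b, v a * ((1 - δ • hessMat U y) a b * v b) := by
      rw [hsym.eigenvalues_eq i]
      simp [dotProduct, Matrix.mulVec, Finset.mul_sum, hv]
    have e2 : ∑ a, ∑ b, v a * ((1 - δ • hessMat U y) a b * v b)
        = ∑ a, v a * v a - δ * fderiv ℝ (fderiv ℝ U) y v v := by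
      rw [aux_bilin_expand _ v v, Finset.mul_sum, ← Finset.sum_sub_distrib]
      refine Finset.sum_congr rfl fun a _ => ?_
      have : v a * v a = ∑ b, v a * ((1 : Matrix (Fin d) (Fin d) ℝ) a b * v b) := by
        simp [Matrix.one_apply]
      rw [this, Finset.mul_sum, ← Finset.sum_sub_distrib]
      refine Finset.sum_congr rfl fun b _ => ?_
      rw [← aux_hess_apply]
      simp only [Matrix.sub_apply, Matrix.smul_apply, smul_eq_mul]
      ring
    have e3 : ∑ a, v a * v a = 1 := by
      have := EuclideanSpace.real_norm_sq_eq v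
      rw [hvn] at this
      rw [← show (1:ℝ)^2 = 1 by norm_num, this]
      exact Finset.sum_congr rfl fun a _ => by ring
    have b1 := hLB y v
    have b2 := hUB y v
    rw [iteratedFDeriv_two_apply, hvn] at b1 b2
    simp only [Matrix.cons_val_zero, Matrix.cons_val_one, one_pow, mul_one] at b1 b2
    rw [e1, e2, e3]
    constructor
    · nlinarith
    · nlinarith
  have hpos : ∀ i, 0 < hsym.eigenvalues i := fun i => by
    have := (hev i).1; linarith
  have hdet : (1 - δ • hessMat U y).det = ∏ i, hsym.eigenvalues i := by
    simpa using hsym.det_eq_prod_eigenvalues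
  have htr : δ * (hessMat U y).trace = ∑ i, (1 - hsym.eigenvalues i) := by
    have := hsym.trace_eq_sum_eigenvalues
    simp only [Matrix.trace_sub, Matrix.trace_one, Matrix.trace_smul, Fintype.card_fin,
      smul_eq_mul, RCLike.ofReal_real_eq_id, id] at this
    rw [Finset.sum_sub_distrib, ← this]
    simp
  refine ⟨by rw [hdet]; exact Finset.prod_pos fun i _ => hpos i, ?_⟩
  rw [htr, hdet, Real.log_prod (fun i _ => (hpos i).ne'), ← Finset.sum_neg_distrib,
    ← Finset.sum_sub_distrib]
  refine (Finset.abs_sum_le_sum_abs _ _).trans ?_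
  calc _ ≤ ∑ i : Fin d, 2 * (δ * L) ^ 2 := by
        refine Finset.sum_le_sum fun i _ => ?_
        obtain ⟨h1, h2⟩ := hev i
        set u := 1 - hsym.eigenvalues i with hu
        have hu0 : 0 ≤ u := by linarith
        have hu1 : u ≤ δ * L := by linarith
        have := Real.abs_log_sub_add_sum_range_le (x := u) (by rw [abs_of_nonneg hu0]; linarith) 1
        rw [abs_of_nonneg hu0] at this
        simp only [Finset.sum_range_one, zero_add, pow_one, Nat.cast_zero, div_one] at this
        have e : 1 - u = hsym.eigenvalues i := by rw [hu]; ring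
        rw [e] at this
        rw [show -Real.log (hsym.eigenvalues i) - u = -(u + Real.log (hsym.eigenvalues i)) by ring,
          abs_neg]
        refine this.trans ?_
        rw [div_le_iff₀ (hpos i)]
        norm_num
        nlinarith [sq_nonneg u, mul_le_mul hu1 hu1 hu0 (by positivity)]
    _ = _ := by simp

end matrix_lemmas

theorem num_n {p K w r n : ℝ} (hp : 0 < p) (hK : 2 ≤ K) (hw : w = p * K) (hw1 : w ≤ 1 / 512)
    (hr : 0 ≤ r) (hn : 0 ≤ n) (h : n ≤ p ^ 2 * (r + n) + 1.415 * p) :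
    p ≤ 1 / 1024 ∧ n ≤ 1.42 * p * (1 + r) := by
  have hp1 : p ≤ 1 / 1024 := by nlinarith
  refine ⟨hp1, ?_⟩
  have h1 : p ^ 2 ≤ 1 / 1024 * p := by nlinarith
  have h2 : p ^ 2 ≤ 1 / 1024 * (1 / 1024) := by nlinarith
  have h3 : p ^ 2 * r ≤ 1 / 1024 * (p * r) := by nlinarith
  have h4 : p ^ 2 * n ≤ 1 / 1024 * (1 / 1024) * n := by nlinarith
  have h5 : 0 ≤ p * r := by positivity
  linarith

theorem num_Z {p K w r n d : ℝ} (hp : 0 < p) (hK : 2 ≤ K) (hw : w = p * K)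
    (hp1 : p ≤ 1 / 1024) (hr : 0 ≤ r) (hn : 0 ≤ n) (hd : 1 ≤ d) (hdK : d ≤ K)
    (h : n ≤ 1.42 * p * (1 + r)) :
    K * r * n + K * n ^ 2 + d * p ^ 2 + d * (2 * (p ^ 2) ^ 2) ≤ 1.6 * w * (1 + r) ^ 2 := by
  have hw0 : 0 < w := by rw [hw]; positivity
  have h1 : K * r * n ≤ 1.42 * w * (r * (1 + r)) := by
    calc K * r * n ≤ K * r * (1.42 * p * (1 + r)) := by gcongr
      _ = _ := by rw [hw]; ring
  have h2 : K * n ^ 2 ≤ 0.003 * w * (1 + r) ^ 2 := by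
    calc K * n ^ 2 ≤ K * (1.42 * p * (1 + r)) ^ 2 := by gcongr
      _ = 1.42 ^ 2 * p * (w * (1 + r) ^ 2) := by rw [hw]; ring
      _ ≤ 1.42 ^ 2 * (1 / 1024) * (w * (1 + r) ^ 2) := by gcongr
      _ ≤ _ := by
        have : 0 ≤ w * (1 + r) ^ 2 := by positivity
        norm_num; linarith
  have h3 : d * p ^ 2 ≤ 0.001 * w := by
    calc d * p ^ 2 ≤ K * p ^ 2 := by gcongr
      _ = p * w := by rw [hw]; ring
      _ ≤ 1 / 1024 * w := by gcongr
      _ ≤ _ := by norm_num; linarith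
  have h4 : d * (2 * (p ^ 2) ^ 2) ≤ 0.001 * w := by
    have : 2 * p ^ 2 ≤ 1 := by nlinarith
    calc d * (2 * (p ^ 2) ^ 2) = d * p ^ 2 * (2 * p ^ 2) := by ring
      _ ≤ d * p ^ 2 * 1 := by gcongr
      _ ≤ _ := by linarith
  nlinarith [mul_nonneg hw0.le hr, mul_nonneg hw0.le (sq_nonneg r)]

theorem num_b0 {p K w r d : ℝ} (hp : 0 < p) (hK : 2 ≤ K) (hw : w = p * K)
    (hr : 0 ≤ r) (hdK : d ≤ K) :
    p ^ 2 * K * r ^ 2 + p ^ 2 * K + p ^ 2 * d ≤ w ^ 2 * (1 + r) ^ 2 := by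
  have h1 : p ^ 2 * d ≤ p ^ 2 * K := by gcongr
  have h2 : 2 * (p ^ 2 * K) ≤ w ^ 2 := by
    rw [hw]
    have : 0 ≤ p ^ 2 * K := by positivity
    nlinarith
  have h3 : 2 * (p ^ 2 * K) * (1 + r) ^ 2 ≤ w ^ 2 * (1 + r) ^ 2 := by gcongr
  have : 0 ≤ p ^ 2 * K := by positivity
  nlinarith [mul_nonneg this hr, mul_nonneg this (sq_nonneg r)]

theorem num_e {p K w r n d : ℝ} (hp : 0 < p) (hK : 2 ≤ K) (hw : w = p * K)
    (hp1 : p ≤ 1 / 1024) (hr : 0 ≤ r) (hn : 0 ≤ n) (hd : 1 ≤ d)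
    (h : n ≤ 1.42 * p * (1 + r)) :
    p ^ 2 * r * K * n + 1.415 * p ^ 3 * K * (r + n) + 1 / 2 * p ^ 4 * K * (r + n) ^ 2 + K * n ^ 3
      + d * (2 * (p ^ 2) ^ 2) + d * p ^ 2 * n ≤ 2 * w ^ 3 * d * (1 + r) ^ 3 := by
  set X := 1 + r with hX
  have hX1 : 1 ≤ X := by linarith
  have hrX : r ≤ X := by linarith
  set A := p ^ 3 * K * d * X ^ 3 with hA
  have hX2 : X ^ 2 ≤ X ^ 3 := pow_le_pow_right₀ hX1 (by norm_num)
  have hX3 : X ≤ X ^ 3 := by simpa using pow_le_pow_right₀ hX1 (show 1 ≤ 3 by norm_num)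
  have hX4 : 1 ≤ X ^ 3 := one_le_pow₀ hX1
  have hA0 : 0 ≤ A := by positivity
  have hrn : r + n ≤ 1.01 * X := by nlinarith
  have c1 : p ^ 2 * r * K * n ≤ 1.42 * A := by
    calc p ^ 2 * r * K * n ≤ p ^ 2 * X * K * (1.42 * p * X) := by gcongr
      _ = 1.42 * (p ^ 3 * K * 1 * X ^ 2) := by ring
      _ ≤ 1.42 * (p ^ 3 * K * d * X ^ 3) := by gcongr
  have c2 : 1.415 * p ^ 3 * K * (r + n) ≤ 1.43 * A := by
    calc 1.415 * p ^ 3 * K * (r + n) ≤ 1.415 * p ^ 3 * K * (1.01 * X) := by gcongr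
      _ = (1.415 * 1.01) * (p ^ 3 * K * 1 * X) := by ring
      _ ≤ 1.43 * (p ^ 3 * K * d * X ^ 3) := by gcongr; norm_num
  have c3 : 1 / 2 * p ^ 4 * K * (r + n) ^ 2 ≤ 0.01 * A := by
    calc 1 / 2 * p ^ 4 * K * (r + n) ^ 2 ≤ 1 / 2 * p ^ 4 * K * (1.01 * X) ^ 2 := by gcongr
      _ = (1 / 2 * 1.01 ^ 2 * p) * (p ^ 3 * K * 1 * X ^ 2) := by ring
      _ ≤ 0.01 * (p ^ 3 * K * d * X ^ 3) := by gcongr; linarith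
  have c4 : K * n ^ 3 ≤ 2.9 * A := by
    calc K * n ^ 3 ≤ K * (1.42 * p * X) ^ 3 := by gcongr
      _ = 1.42 ^ 3 * (p ^ 3 * K * 1 * X ^ 3) := by ring
      _ ≤ 2.9 * (p ^ 3 * K * d * X ^ 3) := by gcongr; norm_num
  have c5 : d * (2 * (p ^ 2) ^ 2) ≤ 0.01 * A := by
    calc d * (2 * (p ^ 2) ^ 2) = (2 * p) * (p ^ 3 * 1 * d * 1) := by ring
      _ ≤ 0.01 * (p ^ 3 * K * d * X ^ 3) := by gcongr <;> linarith
  have c6 : d * p ^ 2 * n ≤ 0.71 * A := by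
    calc d * p ^ 2 * n ≤ d * p ^ 2 * (1.42 * p * X) := by gcongr
      _ = 0.71 * (p ^ 3 * 2 * d * X) := by ring
      _ ≤ 0.71 * (p ^ 3 * K * d * X ^ 3) := by gcongr
  have hfin : 4 * A ≤ w ^ 3 * d * X ^ 3 := by
    calc 4 * A = p ^ 3 * (2 ^ 2 * K) * d * X ^ 3 := by rw [hA]; ring
      _ ≤ p ^ 3 * (K ^ 2 * K) * d * X ^ 3 := by gcongr
      _ = _ := by rw [hw]; ring
  linarith

theorem num_fin {w r d m Z a b : ℝ} (hw0 : 0 < w) (hw1 : w ≤ 1 / 512) (hwm : w ≤ m / 512)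
    (hr : 0 ≤ r) (hd : 1 ≤ d) (hZ : |Z| ≤ 1.6 * w * (1 + r) ^ 2) (ha : |a| ≤ 1.415 * w * r)
    (hb : |b| ≤ w ^ 2 * (1 + r) ^ 2) (he : |Z - a - b| ≤ 2 * w ^ 3 * d * (1 + r) ^ 3) :
    |Real.exp Z - 1 - (a + a ^ 2 / 2 + b)| ≤
      512 * w ^ 3 * d * Real.exp (m / 32 * r ^ 2) * (r ^ 6 + 1) := by
  set X := 1 + r with hX
  have hX1 : 1 ≤ X := by linarith
  have hrX : r ≤ X := by linarith
  have hm : 0 < m := by linarith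
  set e := Real.exp (m / 32 * r ^ 2) with hee
  have he1 : 1 ≤ e := Real.one_le_exp (by positivity)
  have hexp : Real.exp |Z| ≤ 1.1 * e := by
    have h1 : |Z| ≤ 0.01 + m / 32 * r ^ 2 := by
      refine hZ.trans ?_
      have h2 : X ^ 2 ≤ 2 + 2 * r ^ 2 := by rw [hX]; nlinarith [sq_nonneg (r - 1)]
      have h3 : w * r ^ 2 ≤ m / 512 * r ^ 2 := by gcongr
      have h4 : 1.6 * w * X ^ 2 ≤ 1.6 * w * (2 + 2 * r ^ 2) := by gcongr
      have h5 : 0 ≤ m * r ^ 2 := by positivity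
      nlinarith
    calc Real.exp |Z| ≤ Real.exp (0.01 + m / 32 * r ^ 2) := Real.exp_le_exp.2 h1
      _ = Real.exp 0.01 * e := Real.exp_add _ _
      _ ≤ 1.1 * e := by
        gcongr
        have := Real.add_one_le_exp (-(0.01 : ℝ))
        rw [Real.exp_neg] at this
        have hp : 0 < Real.exp 0.01 := Real.exp_pos _
        rw [le_inv_comm₀ (by norm_num) hp] at this
        refine this.trans ?_
        norm_num
  have hX6 : X ^ 6 ≤ 32 * (r ^ 6 + 1) := by
    have := add_pow_le (show (0:ℝ) ≤ 1 by norm_num) hr 6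
    norm_num at this
    rw [hX]; linarith
  have t1 : |Real.exp Z - 1 - Z - Z ^ 2 / 2| ≤ 4.6 * (w ^ 3 * d * X ^ 6 * e) := by
    calc _ ≤ |Z| ^ 3 * Real.exp |Z| := aux_exp Z
      _ ≤ (1.6 * w * X ^ 2) ^ 3 * (1.1 * e) := by gcongr
      _ = (1.6 ^ 3 * 1.1) * (w ^ 3 * 1 * X ^ 6 * e) := by ring
      _ ≤ 4.6 * (w ^ 3 * d * X ^ 6 * e) := by gcongr; norm_num
  have t2 : |Z - a - b| ≤ 2 * (w ^ 3 * d * X ^ 6 * e) := by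
    calc _ ≤ 2 * (w ^ 3 * d * X ^ 3 * 1) := by linarith
      _ ≤ 2 * (w ^ 3 * d * X ^ 6 * e) := by
        gcongr
        · norm_num
  have t3 : |(Z - a) * (Z + a) / 2| ≤ 1.6 * (w ^ 3 * d * X ^ 6 * e) := by
    have h1 : |Z - a| ≤ w ^ 2 * X ^ 2 + 2 * w ^ 3 * d * X ^ 3 := by
      calc |Z - a| = |(Z - a - b) + b| := by congr 1; ring
        _ ≤ |Z - a - b| + |b| := abs_add_le _ _
        _ ≤ _ := by linarith
    have h2 : |Z + a| ≤ 3.1 * w * X ^ 2 := by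
      calc |Z + a| ≤ |Z| + |a| := abs_add_le _ _
        _ ≤ 1.6 * w * X ^ 2 + 1.415 * w * r := by linarith
        _ ≤ _ := by
          have : r ≤ X ^ 2 := by nlinarith
          have : w * r ≤ w * X ^ 2 := by gcongr
          have : 0 ≤ w * X ^ 2 := by positivity
          linarith
    have h3 : |(Z - a) * (Z + a) / 2| = |Z - a| * |Z + a| / 2 := by
      rw [abs_div, abs_mul, abs_two]
    rw [h3]
    have h4 : |Z - a| * |Z + a| ≤ (w ^ 2 * X ^ 2 + 2 * w ^ 3 * d * X ^ 3) * (3.1 * w * X ^ 2) := by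
      gcongr
    have h5 : w ^ 3 * 1 * X ^ 4 * 1 ≤ w ^ 3 * d * X ^ 6 * e := by
      gcongr
      · norm_num
    have h6 : w ^ 4 * d * X ^ 5 ≤ 1 / 512 * (w ^ 3 * d * X ^ 6 * e) := by
      calc w ^ 4 * d * X ^ 5 = w * (w ^ 3 * d * X ^ 5 * 1) := by ring
        _ ≤ 1 / 512 * (w ^ 3 * d * X ^ 6 * e) := by
          gcongr
          · norm_num
    have h7 : (w ^ 2 * X ^ 2 + 2 * w ^ 3 * d * X ^ 3) * (3.1 * w * X ^ 2) =
      3.1 * (w ^ 3 * 1 * X ^ 4 * 1) + 6.2 * (w ^ 4 * d * X ^ 5) := by ring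
    rw [h7] at h4
    have : 0 ≤ w ^ 3 * d * X ^ 6 * e := by positivity
    linarith
  have hsum : |Real.exp Z - 1 - (a + a ^ 2 / 2 + b)| ≤ 8.2 * (w ^ 3 * d * X ^ 6 * e) := by
    have : Real.exp Z - 1 - (a + a ^ 2 / 2 + b) =
      (Real.exp Z - 1 - Z - Z ^ 2 / 2) + (Z - a - b) + (Z - a) * (Z + a) / 2 := by ring
    rw [this]
    refine (abs_add_three _ _ _).trans ?_
    linarith
  refine hsum.trans ?_
  calc 8.2 * (w ^ 3 * d * X ^ 6 * e) ≤ 8.2 * (w ^ 3 * d * (32 * (r ^ 6 + 1)) * e) := by gcongr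
    _ = (8.2 * 32) * (w ^ 3 * d * (r ^ 6 + 1) * e) := by ring
    _ ≤ 512 * (w ^ 3 * d * (r ^ 6 + 1) * e) := by gcongr; norm_num
    _ = _ := by ring

set_option maxHeartbeats 2000000 in
theorem aux_pointwise {d : ℕ} (hd : 0 < d)
    (U : EuclideanSpace ℝ (Fin d) → ℝ) (m L : ℝ) (hm : 0 < m) (hmL : m ≤ L) (hdL : (d : ℝ) ≤ L)
    (hU : ContDiff ℝ 3 U) (hgrad0 : gradient U 0 = 0)
    (hHessLB : ∀ x v, m * ‖v‖ ^ 2 ≤ iteratedFDeriv ℝ 2 U x ![v, v])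
    (hHessUB : ∀ x v, iteratedFDeriv ℝ 2 U x ![v, v] ≤ L * ‖v‖ ^ 2)
    (hD3 : ∀ x, ‖iteratedFDeriv ℝ 3 U x‖ ≤ L)
    (δ : ℝ) (hδ0 : 0 < δ) (hδ : δ ≤ min (m ^ 2) 1 / (2 ^ 18 * d * (L + 1) ^ 3))
    (x y t : EuclideanSpace ℝ (Fin d)) (ht : ‖t‖ ≤ Real.sqrt L)
    (hy : y - δ • gradient U y + Real.sqrt (2 * δ) • t = x) :
    |Real.exp (-U y) * ((1 - δ • hessMat U y).det)⁻¹ / Real.exp (-U x) - 1 -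
      (Real.sqrt (2 * δ) * fderiv ℝ U x t + δ * (fderiv ℝ U x t) ^ 2 +
        (-(δ * ‖gradient U x‖ ^ 2) - δ * fderiv ℝ (fderiv ℝ U) x t t
          + δ * (hessMat U x).trace))| ≤
        512 * (δ * Real.sqrt δ) * (d : ℝ) * ((L + 1) ^ 4 * Real.sqrt (L + 1)) *
          Real.exp (m / 32 * ‖x‖ ^ 2) * (‖x‖ ^ 6 + 1) := by
  have hd1 : (1 : ℝ) ≤ d := by exact_mod_cast hd
  have hL1 : 1 ≤ L := hd1.trans hdL
  have hL0 : 0 ≤ L := by linarith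
  have hD2 := aux_D2_norm hU hm hmL hHessLB hHessUB
  set K := L + 1 with hKdef
  have hK : 2 ≤ K := by linarith
  have hLK : L ≤ K := by linarith
  have hdK : (d : ℝ) ≤ K := by linarith
  set p := Real.sqrt δ * Real.sqrt K with hpdef
  have hsδ : 0 < Real.sqrt δ := Real.sqrt_pos.2 hδ0
  have hsK : 0 < Real.sqrt K := Real.sqrt_pos.2 (by linarith)
  have hp : 0 < p := by positivity
  have hp2 : p ^ 2 = δ * K := by
    rw [hpdef, mul_pow, Real.sq_sqrt hδ0.le, Real.sq_sqrt (by linarith)]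
  set w := p * K with hw
  have hw0 : 0 < w := by positivity
  -- size of `w`
  have hw2 : w ^ 2 ≤ min (m ^ 2) 1 / 2 ^ 18 := by
    have h1 : w ^ 2 = δ * K ^ 3 := by rw [hw, mul_pow, hp2]; ring
    rw [h1]
    rw [le_div_iff₀ (by positivity)] at hδ ⊢
    have : δ * K ^ 3 * 2 ^ 18 * 1 ≤ δ * K ^ 3 * 2 ^ 18 * d := by gcongr
    linarith
  have hw1 : w ≤ 1 / 512 := by
    apply le_of_sq_le_sq _ (by norm_num)
    have := min_le_right (m ^ 2) (1 : ℝ)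
    norm_num at hw2 ⊢
    linarith
  have hwm : w ≤ m / 512 := by
    apply le_of_sq_le_sq _ (by positivity)
    have := min_le_left (m ^ 2) (1 : ℝ)
    norm_num [div_pow] at hw2 ⊢
    linarith
  -- `s`
  set s := Real.sqrt (2 * δ) with hs
  have hs0 : 0 ≤ s := Real.sqrt_nonneg _
  have hs2 : s ^ 2 = 2 * δ := Real.sq_sqrt (by positivity)
  have hst : s * ‖t‖ ≤ 1.415 * p := by
    have h1 : ‖t‖ ^ 2 ≤ K := by
      calc ‖t‖ ^ 2 ≤ (Real.sqrt L) ^ 2 := by gcongr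
        _ = L := Real.sq_sqrt hL0
        _ ≤ K := hLK
    apply le_of_sq_le_sq _ (by positivity)
    rw [mul_pow, mul_pow, hs2, hp2]
    have : δ * ‖t‖ ^ 2 ≤ δ * K := by gcongr
    have : 0 ≤ δ * K := by positivity
    norm_num
    linarith
  have ht2 : ‖t‖ ^ 2 ≤ K := by
    calc ‖t‖ ^ 2 ≤ (Real.sqrt L) ^ 2 := by gcongr
      _ = L := Real.sq_sqrt hL0
      _ ≤ K := hLK
  set r := ‖x‖ with hr
  have hr0 : 0 ≤ r := norm_nonneg _
  set n := ‖y - x‖ with hn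
  have hn0 : 0 ≤ n := norm_nonneg _
  set g := gradient U x with hg
  set G := gradient U y with hG
  have hgn : ‖g‖ ≤ K * r := by
    have := aux_grad_lip hU hD2 0 x
    rw [hgrad0, sub_zero, sub_zero] at this
    exact this.trans (by gcongr)
  have hGg : ‖G - g‖ ≤ K * n := (aux_grad_lip hU hD2 x y).trans (by gcongr)
  have hGn : ‖G‖ ≤ K * (r + n) := by
    calc ‖G‖ = ‖(G - g) + g‖ := by congr 1; abel
      _ ≤ ‖G - g‖ + ‖g‖ := norm_add_le _ _
      _ ≤ _ := by linarith
  have hΔ : y - x = δ • G - s • t := by rw [← hy]; abel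
  have hnle : n ≤ p ^ 2 * (r + n) + 1.415 * p := by
    calc n = ‖δ • G - s • t‖ := by rw [hn, hΔ]
      _ ≤ ‖δ • G‖ + ‖s • t‖ := norm_sub_le _ _
      _ = δ * ‖G‖ + s * ‖t‖ := by
        rw [norm_smul, norm_smul, Real.norm_of_nonneg hδ0.le, Real.norm_of_nonneg hs0]
      _ ≤ δ * (K * (r + n)) + 1.415 * p := by gcongr
      _ = _ := by rw [hp2]; ring
  obtain ⟨hp1, hn1⟩ := num_n hp hK hw hw1 hr0 hn0 hnle
  -- determinant
  have hδL : δ * L ≤ 1 / 2 := by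
    have h1 : δ * L ≤ δ * K := by gcongr
    rw [← hp2] at h1
    nlinarith
  obtain ⟨hdetpos, hdet⟩ := aux_det hU hm hmL hHessLB hHessUB hδ0 hδL y
  set D := (1 - δ • hessMat U y).det with hD
  set tr := (hessMat U x).trace with htr
  set trY := (hessMat U y).trace with htrY
  have htrd : |trY - tr| ≤ d * (K * n) := (aux_trace_diff hU hD3 x y).trans (by gcongr)
  have htrb : |tr| ≤ d * K := (aux_trace_bound hD2 x).trans (by gcongr)
  have htrYb : |trY| ≤ d * K := (aux_trace_bound hD2 y).trans (by gcongr)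
  have hdet' : |-Real.log D - δ * trY| ≤ d * (2 * (p ^ 2) ^ 2) := by
    refine hdet.trans ?_
    rw [hp2]; gcongr
  -- the exponent
  set Z := (U x - U y) - Real.log D with hZ
  have hlhs : Real.exp (-U y) * D⁻¹ / Real.exp (-U x) = Real.exp Z := by
    rw [hZ, Real.exp_sub, Real.exp_log hdetpos, sub_eq_add_neg, Real.exp_add, Real.exp_neg (U x)]
    field_simp
  have hfd : ∀ v, |fderiv ℝ U x v| ≤ K * r * ‖v‖ := by
    intro v
    rw [← inner_gradient_left]
    exact (abs_real_inner_le_norm _ _).trans (by gcongr)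
  set B := fderiv ℝ (fderiv ℝ U) x with hB
  have hBuv : ∀ u v, |B u v| ≤ K * ‖u‖ * ‖v‖ := by
    intro u v
    refine (B.le_opNorm₂ u v).trans ?_
    have := (hD2 x).trans hLK
    gcongr
  have hZb : |Z| ≤ 1.6 * w * (1 + r) ^ 2 := by
    refine le_trans ?_ (num_Z hp hK hw hp1 hr0 hn0 hd1 hdK hn1)
    have h1 := aux_taylor1 hU hL0 hD2 x y
    have h2 := hfd (y - x)
    have h3 : |δ * trY| ≤ d * p ^ 2 := by
      rw [abs_mul, abs_of_pos hδ0, hp2]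
      calc δ * |trY| ≤ δ * (d * K) := by gcongr
        _ = _ := by ring
    have h4 : L * ‖y - x‖ ^ 2 ≤ K * n ^ 2 := by gcongr
    have : Z = -(U y - U x - fderiv ℝ U x (y - x)) - fderiv ℝ U x (y - x)
      + (-Real.log D - δ * trY) + δ * trY := by rw [hZ]; ring
    rw [this]
    rw [abs_le] at h1 h2 h3 hdet' ⊢
    constructor <;> linarith [h1.1, h1.2, h2.1, h2.2, h3.1, h3.2, hdet'.1, hdet'.2]
  have hab : |s * fderiv ℝ U x t| ≤ 1.415 * w * r := by
    rw [abs_mul, abs_of_nonneg hs0]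
    calc s * |fderiv ℝ U x t| ≤ s * (K * r * ‖t‖) := by gcongr; exact hfd t
      _ = K * r * (s * ‖t‖) := by ring
      _ ≤ K * r * (1.415 * p) := by gcongr
      _ = _ := by rw [hw]; ring
  have hbb : |-(δ * ‖g‖ ^ 2) - δ * B t t + δ * tr| ≤ w ^ 2 * (1 + r) ^ 2 := by
    refine le_trans ?_ (num_b0 hp hK hw hr0 hdK)
    have h1 : δ * ‖g‖ ^ 2 ≤ p ^ 2 * K * r ^ 2 := by
      calc δ * ‖g‖ ^ 2 ≤ δ * (K * r) ^ 2 := by gcongr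
        _ = _ := by rw [hp2]; ring
    have h1' : 0 ≤ δ * ‖g‖ ^ 2 := by positivity
    have h2 : |δ * B t t| ≤ p ^ 2 * K := by
      rw [abs_mul, abs_of_pos hδ0]
      calc δ * |B t t| ≤ δ * (K * ‖t‖ * ‖t‖) := by gcongr; exact hBuv t t
        _ = δ * K * ‖t‖ ^ 2 := by ring
        _ ≤ δ * K * K := by gcongr
        _ = _ := by rw [hp2]
    have h3 : |δ * tr| ≤ p ^ 2 * d := by
      rw [abs_mul, abs_of_pos hδ0, hp2]
      calc δ * |tr| ≤ δ * (d * K) := by gcongr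
        _ = _ := by ring
    rw [abs_le] at h2 h3 ⊢
    constructor <;> linarith [h2.1, h2.2, h3.1, h3.2]
  have heb : |Z - s * fderiv ℝ U x t - (-(δ * ‖g‖ ^ 2) - δ * B t t + δ * tr)|
      ≤ 2 * w ^ 3 * d * (1 + r) ^ 3 := by
    refine le_trans ?_ (num_e hp hK hw hp1 hr0 hn0 hd1 hn1)
    have h1 := aux_taylor2 hU hL0 hD3 x y
    rw [← hB] at h1
    have h1' : L * ‖y - x‖ ^ 3 ≤ K * n ^ 3 := by gcongr
    have e1 : fderiv ℝ U x (y - x) = δ * ‖g‖ ^ 2 + δ * inner ℝ g (G - g) - s * fderiv ℝ U x t := by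
      rw [hΔ, map_sub, map_smul, map_smul, ← inner_gradient_left (y := G), ← hg, inner_sub_right,
        real_inner_self_eq_norm_sq]
      simp only [smul_eq_mul]; ring
    have e2 : B (y - x) (y - x) = 2 * δ * B t t - 2 * (s * δ * B t G) + δ ^ 2 * B G G := by
      have hsy := aux_symm hU x G t
      rw [← hB] at hsy
      rw [hΔ]
      simp only [map_sub, map_smul, sub_apply, smul_apply, smul_eq_mul]
      rw [hsy, ← hs2]
      ring
    have k1 : |δ * inner ℝ g (G - g)| ≤ p ^ 2 * r * K * n := by
      rw [abs_mul, abs_of_pos hδ0]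
      calc δ * |inner ℝ g (G - g)| ≤ δ * (‖g‖ * ‖G - g‖) := by
            gcongr; exact abs_real_inner_le_norm _ _
        _ ≤ δ * ((K * r) * (K * n)) := by gcongr
        _ = _ := by rw [hp2]; ring
    have k2 : |s * δ * B t G| ≤ 1.415 * p ^ 3 * K * (r + n) := by
      rw [abs_mul, abs_of_nonneg (by positivity)]
      calc s * δ * |B t G| ≤ s * δ * (K * ‖t‖ * ‖G‖) := by gcongr; exact hBuv t G
        _ = (s * ‖t‖) * (δ * K) * ‖G‖ := by ring
        _ ≤ (1.415 * p) * (δ * K) * (K * (r + n)) := by gcongr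
        _ = _ := by rw [← hp2]; ring
    have k3 : |1 / 2 * (δ ^ 2 * B G G)| ≤ 1 / 2 * p ^ 4 * K * (r + n) ^ 2 := by
      rw [abs_mul, abs_mul, abs_of_pos (show (0:ℝ) < 1 / 2 by norm_num),
        abs_of_pos (show 0 < δ ^ 2 by positivity)]
      calc 1 / 2 * (δ ^ 2 * |B G G|) ≤ 1 / 2 * (δ ^ 2 * (K * ‖G‖ * ‖G‖)) := by
            gcongr; exact hBuv G G
        _ ≤ 1 / 2 * (δ ^ 2 * (K * (K * (r + n)) * (K * (r + n)))) := by gcongr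
        _ = 1 / 2 * (δ * K) ^ 2 * K * (r + n) ^ 2 := by ring
        _ = _ := by rw [← hp2]; ring
    have k6 : |δ * (trY - tr)| ≤ d * p ^ 2 * n := by
      rw [abs_mul, abs_of_pos hδ0, hp2]
      calc δ * |trY - tr| ≤ δ * (d * (K * n)) := by gcongr
        _ = _ := by ring
    have : Z - s * fderiv ℝ U x t - (-(δ * ‖g‖ ^ 2) - δ * B t t + δ * tr) =
        -(U y - U x - fderiv ℝ U x (y - x) - 1 / 2 * B (y - x) (y - x))
        - δ * inner ℝ g (G - g) + s * δ * B t G - 1 / 2 * (δ ^ 2 * B G G)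
        + (-Real.log D - δ * trY) + δ * (trY - tr) := by
      rw [e1, e2, hZ]; ring
    rw [this]
    rw [abs_le] at h1 k1 k2 k3 k6 hdet' ⊢
    constructor <;> linarith [h1.1, h1.2, k1.1, k1.2, k2.1, k2.2, k3.1, k3.2, k6.1, k6.2,
      hdet'.1, hdet'.2]
  have hfin := num_fin hw0 hw1 hwm hr0 hd1 hZb hab hbb heb
  rw [hlhs]
  have e3 : (s * fderiv ℝ U x t) ^ 2 / 2 = δ * (fderiv ℝ U x t) ^ 2 := by
    rw [mul_pow, hs2]; ring
  rw [e3] at hfin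
  refine hfin.trans (le_of_eq ?_)
  have e4 : w ^ 3 = (δ * Real.sqrt δ) * (K ^ 4 * Real.sqrt K) := by
    have h1 : Real.sqrt δ ^ 2 = δ := Real.sq_sqrt hδ0.le
    have h2 : Real.sqrt K ^ 2 = K := Real.sq_sqrt (by linarith)
    calc w ^ 3 = (Real.sqrt δ ^ 2 * Real.sqrt δ) * ((Real.sqrt K ^ 2) * K ^ 3 * Real.sqrt K) := by
          rw [hw, hpdef]; ring
      _ = _ := by rw [h1, h2]; ring
  rw [e4]; ring

theorem aux_anti {E : Type*} [NormedAddCommGroup E] [NormedSpace ℝ E] (g : E → E) {L δ : ℝ}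
    (hδ : 0 < δ) (hδL : δ * L ≤ 1 / 2) (hg : ∀ x y, ‖g y - g x‖ ≤ L * ‖y - x‖) :
    AntilipschitzWith 2 (fun y => y - δ • g y) := by
  refine AntilipschitzWith.of_le_mul_dist fun x y => ?_
  rw [dist_eq_norm, dist_eq_norm]
  have h1 : x - y = (x - δ • g x - (y - δ • g y)) + δ • (g x - g y) := by
    rw [smul_sub]; abel
  have h2 : ‖x - y‖ ≤ ‖x - δ • g x - (y - δ • g y)‖ + δ * ‖g x - g y‖ := by
    calc ‖x - y‖ = ‖(x - δ • g x - (y - δ • g y)) + δ • (g x - g y)‖ := by rw [← h1]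
      _ ≤ _ := (norm_add_le _ _).trans (by rw [norm_smul, Real.norm_of_nonneg hδ.le])
  have h3 : δ * ‖g x - g y‖ ≤ 1 / 2 * ‖x - y‖ := by
    calc δ * ‖g x - g y‖ ≤ δ * (L * ‖x - y‖) := by gcongr; exact hg y x
      _ = (δ * L) * ‖x - y‖ := by ring
      _ ≤ _ := by gcongr
  have h4 : ((2 : NNReal) : ℝ) = 2 := rfl
  rw [h4]
  linarith

theorem aux_surj {E : Type*} [NormedAddCommGroup E] [NormedSpace ℝ E] [CompleteSpace E]
    (g : E → E) {L δ : ℝ}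
    (hδ : 0 < δ) (hδL : δ * L ≤ 1 / 2) (hg : ∀ x y, ‖g y - g x‖ ≤ L * ‖y - x‖) :
    Function.Surjective (fun y => y - δ • g y) := by
  intro c
  have hc : ContractingWith (1 / 2 : NNReal) (fun y => c + δ • g y) := by
    refine ⟨?_, LipschitzWith.of_dist_le_mul fun x y => ?_⟩
    · exact NNReal.half_lt_self one_ne_zero
    · rw [dist_eq_norm, dist_eq_norm, add_sub_add_left_eq_sub, ← smul_sub, norm_smul,
        Real.norm_of_nonneg hδ.le]
      calc δ * ‖g x - g y‖ ≤ δ * (L * ‖x - y‖) := by gcongr; exact hg y x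
        _ = (δ * L) * ‖x - y‖ := by ring
        _ ≤ 1 / 2 * ‖x - y‖ := by gcongr
        _ = _ := by simp
  refine ⟨ContractingWith.fixedPoint _ hc, ?_⟩
  have h : c + δ • g (ContractingWith.fixedPoint _ hc) = ContractingWith.fixedPoint _ hc :=
    hc.fixedPoint_isFixedPt
  show ContractingWith.fixedPoint _ hc - δ • g (ContractingWith.fixedPoint _ hc) = c
  rw [sub_eq_iff_eq_add, h]

theorem aux_cov {d : ℕ} {Ω : Type*} [MeasurableSpace Ω] (P : Measure Ω) [IsProbabilityMeasure P]
    (T : Ω → EuclideanSpace ℝ (Fin d)) (hTmeas : Measurable T) (L : ℝ) (hL : 0 ≤ L)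
    (hTcov : ∀ i j, ∫ η, T η i * T η j ∂P = (1 : Matrix (Fin d) (Fin d) ℝ) i j)
    (hTbd : ∀ᵐ η ∂P, ‖T η‖ ≤ Real.sqrt L)
    (C : EuclideanSpace ℝ (Fin d) →L[ℝ] EuclideanSpace ℝ (Fin d) →L[ℝ] ℝ) :
    Integrable (fun η => C (T η) (T η)) P ∧
    ∫ η, C (T η) (T η) ∂P
      = ∑ i, C (EuclideanSpace.single i 1) (EuclideanSpace.single i 1) := by
  have hmi : ∀ i, Measurable (fun η => T η i) := fun i => by fun_prop
  have hTij : ∀ i j, Integrable (fun η => T η i * T η j) P := by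
    intro i j
    refine Integrable.of_bound ((hmi i).mul (hmi j)).aestronglyMeasurable L ?_
    filter_upwards [hTbd] with η hη
    have h1 : ‖T η i‖ ≤ Real.sqrt L := (PiLp.norm_apply_le (T η) i).trans hη
    have h2 : ‖T η j‖ ≤ Real.sqrt L := (PiLp.norm_apply_le (T η) j).trans hη
    rw [norm_mul]
    calc ‖T η i‖ * ‖T η j‖ ≤ Real.sqrt L * Real.sqrt L := by gcongr
      _ = L := Real.mul_self_sqrt hL
  have hfun : (fun η => C (T η) (T η)) = fun η => ∑ i, ∑ j,
      C (EuclideanSpace.single i 1) (EuclideanSpace.single j 1) * (T η i * T η j) := by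
    funext η; exact aux_bilin_expand C _ _
  rw [hfun]
  refine ⟨integrable_finsetSum _ fun i _ => integrable_finsetSum _ fun j _ =>
    (hTij i j).const_mul _, ?_⟩
  rw [integral_finsetSum _ fun i _ => integrable_finsetSum _ fun j _ => (hTij i j).const_mul _]
  refine Finset.sum_congr rfl fun i _ => ?_
  rw [integral_finsetSum _ fun j _ => (hTij i j).const_mul _]
  simp only [integral_const_mul, hTcov]
  simp [Matrix.one_apply]

theorem stmt8 {d : ℕ} (hd : 0 < d)
    {Ω : Type*} [MeasurableSpace Ω] (P : Measure Ω) [IsProbabilityMeasure P]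
    (T : Ω → EuclideanSpace ℝ (Fin d)) (hTmeas : Measurable T)
    (U : EuclideanSpace ℝ (Fin d) → ℝ) (m L : ℝ) (hm : 0 < m) (hmL : m ≤ L)
    (hU : ContDiff ℝ 3 U) (hgrad0 : gradient U 0 = 0)
    (hHessLB : ∀ x v, m * ‖v‖ ^ 2 ≤ iteratedFDeriv ℝ 2 U x ![v, v])
    (hHessUB : ∀ x v, iteratedFDeriv ℝ 2 U x ![v, v] ≤ L * ‖v‖ ^ 2)
    (hD3 : ∀ x, ‖iteratedFDeriv ℝ 3 U x‖ ≤ L)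
    (hTmean : ∫ η, T η ∂P = 0)
    (hTcov : ∀ i j, ∫ η, T η i * T η j ∂P = (1 : Matrix (Fin d) (Fin d) ℝ) i j)
    (hTbd : ∀ᵐ η ∂P, ‖T η‖ ≤ Real.sqrt L)
    (δ : ℝ) (hδ0 : 0 < δ) (hδ : δ ≤ min (m ^ 2) 1 / (2 ^ 18 * d * (L + 1) ^ 3))
    (F : Ω → EuclideanSpace ℝ (Fin d) → EuclideanSpace ℝ (Fin d))
    (hF : ∀ η y, F η y = y - δ • gradient U y + Real.sqrt (2 * δ) • T η) :
    (∀ η, Function.Bijective (F η)) ∧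
    ∀ x : EuclideanSpace ℝ (Fin d),
      |(∫ η, Real.exp (-U (Function.invFun (F η) x)) *
            ((1 - δ • hessMat U (Function.invFun (F η) x)).det)⁻¹ ∂P) /
          Real.exp (-U x) - 1| ≤
        512 * (δ * Real.sqrt δ) * (d : ℝ) * ((L + 1) ^ 4 * Real.sqrt (L + 1)) *
          Real.exp (m / 32 * ‖x‖ ^ 2) * (‖x‖ ^ 6 + 1) := by
  have hL0 : 0 < L := lt_of_lt_of_le hm hmL
  have hd1 : (1 : ℝ) ≤ d := by exact_mod_cast hd
  have hD2 := aux_D2_norm hU hm hmL hHessLB hHessUB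
  have hlip := aux_grad_lip hU hD2
  have hcov := aux_cov P T hTmeas L hL0.le hTcov hTbd
  -- dimension bound
  have hdL : (d : ℝ) ≤ L := by
    obtain ⟨hi, he⟩ := hcov (innerSL ℝ)
    have h1 : ∫ η, (innerSL ℝ (T η)) (T η) ∂P = d := by
      rw [he]
      calc _ = ∑ i : Fin d, (1 : ℝ) := by
            refine Finset.sum_congr rfl fun i _ => ?_
            rw [innerSL_apply_apply, real_inner_self_eq_norm_sq, PiLp.norm_single]
            norm_num
        _ = d := by simp
    rw [← h1]
    calc ∫ η, (innerSL ℝ (T η)) (T η) ∂P ≤ ∫ η, L ∂P := by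
          refine integral_mono_ae hi (integrable_const _) ?_
          filter_upwards [hTbd] with η hη
          have : (innerSL ℝ (T η)) (T η) = ‖T η‖ ^ 2 := by
            rw [innerSL_apply_apply, real_inner_self_eq_norm_sq]
          show (innerSL ℝ (T η)) (T η) ≤ L
          rw [this]
          calc ‖T η‖ ^ 2 ≤ (Real.sqrt L) ^ 2 := by gcongr
            _ = L := Real.sq_sqrt hL0.le
      _ = L := by simp
  have hδL : δ * L ≤ 1 / 2 := by
    have h1 : min (m ^ 2) 1 ≤ 1 := min_le_right _ _
    rw [le_div_iff₀ (by positivity)] at hδ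
    have h2 : L ≤ (L + 1) ^ 3 := by
      have : 0 ≤ L ^ 3 + 3 * L ^ 2 + 2 * L + 1 := by positivity
      linarith [show (L + 1) ^ 3 = L ^ 3 + 3 * L ^ 2 + 2 * L + 1 + L by ring]
    have h3 : δ * (2 * 1 * L) ≤ δ * (2 ^ 18 * d * (L + 1) ^ 3) := by
      gcongr; norm_num
    linarith
  have hanti := aux_anti (gradient U) hδ0 hδL hlip
  have hsurj := aux_surj (gradient U) hδ0 hδL hlip
  set G : EuclideanSpace ℝ (Fin d) → EuclideanSpace ℝ (Fin d) :=
    fun y => y - δ • gradient U y with hG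
  have hFG : ∀ η y, F η y = G y + Real.sqrt (2 * δ) • T η := fun η y => hF η y
  have hbij : ∀ η, Function.Bijective (F η) := by
    intro η
    have : F η = (Equiv.addRight (Real.sqrt (2 * δ) • T η)) ∘ G := by
      funext y; simp [hFG]
    rw [this]
    exact (Equiv.bijective _).comp ⟨hanti.injective, hsurj⟩
  refine ⟨hbij, fun x => ?_⟩
  set s := Real.sqrt (2 * δ) with hs
  have hGinv : Function.RightInverse (Function.invFun G) G :=
    Function.rightInverse_invFun hsurj
  have hGcont : Continuous (Function.invFun G) := (hanti.to_rightInverse hGinv).continuous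
  have hFinv : ∀ η, F η (Function.invFun (F η) x) = x := fun η =>
    Function.rightInverse_invFun (hbij η).2 x
  have hinv : ∀ η, Function.invFun (F η) x = Function.invFun G (x - s • T η) := by
    intro η
    apply hanti.injective
    have h1 := hFinv η
    rw [hFG] at h1
    rw [hGinv]
    exact eq_sub_of_add_eq h1
  set Y : Ω → EuclideanSpace ℝ (Fin d) := fun η => Function.invFun (F η) x with hY
  have hYmeas : Measurable Y := by
    have : Y = fun η => Function.invFun G (x - s • T η) := funext hinv
    rw [this]
    exact hGcont.measurable.comp (by fun_prop)
  have hhess : Continuous (fun y => hessMat U y) := by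
    refine continuous_matrix fun i j => ?_
    have : (fun y => hessMat U y i j) = fun y => fderiv ℝ (fderiv ℝ U) y
      (EuclideanSpace.single i 1) (EuclideanSpace.single j 1) := by
      funext y; exact aux_hess_apply U y i j
    rw [this]
    have := (aux_cd2 hU).continuous
    fun_prop
  have hdetc : Continuous (fun y => (1 - δ • hessMat U y).det) :=
    Continuous.matrix_det (by fun_prop)
  set f : Ω → ℝ := fun η => Real.exp (-U (Y η)) * ((1 - δ • hessMat U (Y η)).det)⁻¹ with hf
  have hfmeas : Measurable f := by
    have h1 : Measurable (fun η => Real.exp (-U (Y η))) := by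
      have : Measurable U := hU.continuous.measurable
      fun_prop
    exact h1.mul ((hdetc.measurable.comp hYmeas).inv)
  -- the quadratic polynomial
  set ℓ := fderiv ℝ U x with hℓ
  set B := fderiv ℝ (fderiv ℝ U) x with hB
  set c : ℝ := -(δ * ‖gradient U x‖ ^ 2) with hc
  set Q : Ω → ℝ := fun η => s * ℓ (T η) + δ * (ℓ (T η)) ^ 2 +
        (c - δ * B (T η) (T η) + δ * (hessMat U x).trace) with hQ
  have hTint : Integrable T P :=
    Integrable.of_bound hTmeas.aestronglyMeasurable _ hTbd
  have i1 : Integrable (fun η => ℓ (T η)) P := ℓ.integrable_comp hTint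
  have v1 : ∫ η, ℓ (T η) ∂P = 0 := by
    rw [ContinuousLinearMap.integral_comp_comm _ hTint, hTmean, map_zero]
  obtain ⟨i2, v2⟩ := hcov (ℓ.smulRight ℓ)
  obtain ⟨i3, v3⟩ := hcov B
  have i2' : Integrable (fun η => (ℓ (T η)) ^ 2) P := by
    refine i2.congr (Filter.Eventually.of_forall fun η => ?_)
    simp [sq]
  have v2' : ∫ η, (ℓ (T η)) ^ 2 ∂P = ‖gradient U x‖ ^ 2 := by
    have e1 : ∫ η, (ℓ (T η)) ^ 2 ∂P = ∫ η, (ℓ.smulRight ℓ) (T η) (T η) ∂P := by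
      refine integral_congr_ae (Filter.Eventually.of_forall fun η => ?_)
      simp [sq]
    rw [e1, v2, EuclideanSpace.real_norm_sq_eq]
    refine Finset.sum_congr rfl fun i _ => ?_
    have : ℓ (EuclideanSpace.single i 1) = gradient U x i := by
      rw [hℓ, ← inner_gradient_left, EuclideanSpace.inner_single_right]; simp only [one_mul, conj_trivial]
    simp [this, sq]
  have v3' : ∫ η, B (T η) (T η) ∂P = (hessMat U x).trace := by
    rw [v3, aux_hess_trace]
  have j1 : Integrable (fun η => s * ℓ (T η) + δ * (ℓ (T η)) ^ 2) P :=
    (i1.const_mul s).add (i2'.const_mul δ)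
  have j2 : Integrable (fun η => c - δ * B (T η) (T η)) P :=
    (integrable_const c).sub (i3.const_mul δ)
  have j3 : Integrable (fun η => c - δ * B (T η) (T η) + δ * (hessMat U x).trace) P :=
    j2.add (integrable_const _)
  have hQint : Integrable Q P := j1.add j3
  have hQ0 : ∫ η, Q η ∂P = 0 := by
    rw [hQ, integral_add j1 j3, integral_add (i1.const_mul s) (i2'.const_mul δ),
      integral_add j2 (integrable_const _), integral_sub (integrable_const c) (i3.const_mul δ),
      integral_const_mul, integral_const_mul, integral_const_mul, v1, v2', v3']
    simp [hc]
  set C : ℝ := 512 * (δ * Real.sqrt δ) * (d : ℝ) * ((L + 1) ^ 4 * Real.sqrt (L + 1)) *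
          Real.exp (m / 32 * ‖x‖ ^ 2) * (‖x‖ ^ 6 + 1) with hC
  have hbound : ∀ᵐ η ∂P, ‖f η / Real.exp (-U x) - 1 - Q η‖ ≤ C := by
    filter_upwards [hTbd] with η hη
    rw [Real.norm_eq_abs]
    refine aux_pointwise hd U m L hm hmL hdL hU hgrad0 hHessLB hHessUB hD3 δ hδ0 hδ x (Y η) (T η)
      hη ?_
    rw [← hF]
    exact hFinv η
  have hRint : Integrable (fun η => f η / Real.exp (-U x) - 1 - Q η) P :=
    Integrable.of_bound
      (((hfmeas.div_const _).sub_const 1).aestronglyMeasurable.sub hQint.aestronglyMeasurable)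
      C hbound
  have hfint : Integrable (fun η => f η / Real.exp (-U x)) P := by
    have := (hRint.add hQint).add (integrable_const (1 : ℝ))
    refine this.congr (Filter.Eventually.of_forall fun η => ?_)
    simp only [Pi.add_apply]
    ring
  have key : (∫ η, f η ∂P) / Real.exp (-U x) - 1 =
      ∫ η, (f η / Real.exp (-U x) - 1 - Q η) ∂P := by
    have h1 : Integrable (fun η => f η / Real.exp (-U x) - 1) P :=
      hfint.sub (integrable_const _)
    rw [integral_sub h1 hQint, integral_sub hfint (integrable_const _), hQ0, integral_div]
    simp
  rw [key, ← Real.norm_eq_abs]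
  have := norm_integral_le_of_norm_le_const hbound
  simpa using this
end

section
/- Let 0 < δ ≤ 1/(2^8 · d² · L) and let x, y ∈ ℝ^d satisfy x = y − δ∇U(y) + √(2δ)·T(y). Then the matrix I − δ∇²U(y) + √(2δ)·DT(y) is invertible and |det(I − δ∇²U(y) + √(2δ)·DT(y))^{-1} − (1 − √(2δ)·tr(DT(x)) + 2δ·tr(M(x)) + δ·tr(∇²U(x)) + δ·(tr DT(x))² + δ·tr(DT(x)²))| ≤ 128·δ^{3/2}·d³·L^{3/2}·(‖x‖₂² + 1), where M(x) is the d×d matrix with entries M(x)_{i,j} = Σ_k (∂²T_i/∂x_j∂x_k)(x)·T_k(x). -/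
/-- The Jacobian matrix of `T : ℝ^d → ℝ^d` at `x`. -/
noncomputable def jacMat {d : ℕ}
    (T : EuclideanSpace ℝ (Fin d) → EuclideanSpace ℝ (Fin d))
    (x : EuclideanSpace ℝ (Fin d)) : Matrix (Fin d) (Fin d) ℝ :=
  fun i j => fderiv ℝ T x (EuclideanSpace.single j 1) i

/-- The matrix with entries `M(x)_{i,j} = Σ_k (∂²T_i/∂x_j∂x_k)(x) · T_k(x)`. -/
noncomputable def secondDerivContraction {d : ℕ}
    (T : EuclideanSpace ℝ (Fin d) → EuclideanSpace ℝ (Fin d))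
    (x : EuclideanSpace ℝ (Fin d)) : Matrix (Fin d) (Fin d) ℝ :=
  fun i j => ∑ k, iteratedFDeriv ℝ 2 (fun z => T z i) x
      ![EuclideanSpace.single j 1, EuclideanSpace.single k 1] * T x k


section aux
set_option maxSynthPendingDepth 3
open scoped Matrix.Norms.L2Operator
open Matrix

lemma prod_inv_approx {ι : Type*} [DecidableEq ι] (l : ι → ℝ) (b : ℝ) (hb0 : 0 ≤ b) (hb : b ≤ 1 / 2)
    (S : Finset ι) (hl : ∀ i ∈ S, |l i| ≤ b) :
    (1 - b) ^ S.card * |(∏ i ∈ S, (1 + l i))⁻¹ -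
      (1 - ∑ i ∈ S, l i + (∑ i ∈ S, l i ^ 2 + (∑ i ∈ S, l i) ^ 2) / 2)| ≤ (S.card * b) ^ 3 := by
  induction S using Finset.induction_on with
  | empty => simp
  | insert a S ha ih =>
    have ih := ih (fun i hi => hl i (Finset.mem_insert_of_mem hi))
    have hla := hl a (Finset.mem_insert_self _ _)
    have hp1 : |∑ i ∈ S, l i| ≤ S.card * b := by
      refine (Finset.abs_sum_le_sum_abs _ _).trans ?_
      refine (Finset.sum_le_card_nsmul _ _ b (fun i hi => hl i (Finset.mem_insert_of_mem hi))).trans ?_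
      simp
    have hp2 : ∑ i ∈ S, l i ^ 2 ≤ S.card * b ^ 2 := by
      refine (Finset.sum_le_card_nsmul _ _ (b ^ 2) (fun i hi => ?_)).trans (by simp)
      rw [← sq_abs]
      exact pow_le_pow_left₀ (abs_nonneg _) (hl i (Finset.mem_insert_of_mem hi)) 2
    have hp2' : 0 ≤ ∑ i ∈ S, l i ^ 2 := Finset.sum_nonneg (fun i _ => sq_nonneg _)
    rw [Finset.prod_insert ha, Finset.sum_insert ha, Finset.sum_insert ha,
      Finset.card_insert_of_notMem ha]
    set P := (∏ i ∈ S, (1 + l i))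
    set p1 := ∑ i ∈ S, l i
    set p2 := ∑ i ∈ S, l i ^ 2
    set n : ℕ := S.card
    set x := l a
    have hx := abs_le.1 hla
    have hx1 : 0 < 1 + x := by linarith
    have e : ((1 + x) * P)⁻¹ - (1 - (x + p1) + (x ^ 2 + p2 + (x + p1) ^ 2) / 2)
        = ((P⁻¹ - (1 - p1 + (p2 + p1 ^ 2) / 2)) - (x * ((p2 + p1 ^ 2) / 2) + x ^ 3 + p1 * x ^ 2)) / (1 + x) := by
      rw [mul_inv]
      field_simp
      ring
    rw [e, abs_div, abs_of_pos hx1]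
    have hn : (0:ℝ) ≤ n := Nat.cast_nonneg n
    have hr : |x * ((p2 + p1 ^ 2) / 2) + x ^ 3 + p1 * x ^ 2| ≤ b ^ 3 * (n ^ 2 + n + 1) := by
      have hp1sq : p1 ^ 2 ≤ (n * b) ^ 2 := by
        rw [← sq_abs]; exact pow_le_pow_left₀ (abs_nonneg _) hp1 2
      have hnn : (n:ℝ) ≤ n ^ 2 := by exact_mod_cast Nat.le_self_pow (by norm_num) n
      have h2 : (p2 + p1 ^ 2) / 2 ≤ n ^ 2 * b ^ 2 := by
        nlinarith [mul_le_mul_of_nonneg_right hnn (sq_nonneg b)]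
      have h2' : 0 ≤ (p2 + p1 ^ 2) / 2 := by positivity
      have hxx : x ^ 2 ≤ b ^ 2 := by
        rw [← sq_abs]; exact pow_le_pow_left₀ (abs_nonneg _) hla 2
      have t1 : |x * ((p2 + p1 ^ 2) / 2)| ≤ b * (n ^ 2 * b ^ 2) := by
        rw [abs_mul, abs_of_nonneg h2']
        exact mul_le_mul hla h2 h2' hb0
      have t2 : |x ^ 3| ≤ b ^ 3 := by
        rw [abs_pow]; exact pow_le_pow_left₀ (abs_nonneg _) hla 3
      have t3 : |p1 * x ^ 2| ≤ (n * b) * b ^ 2 := by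
        rw [abs_mul, abs_of_nonneg (sq_nonneg x)]
        exact mul_le_mul hp1 hxx (sq_nonneg x) (by positivity)
      refine (abs_add_three _ _ _).trans ?_
      nlinarith
    set Q := P⁻¹ - (1 - p1 + (p2 + p1 ^ 2) / 2)
    set R := x * ((p2 + p1 ^ 2) / 2) + x ^ 3 + p1 * x ^ 2
    have hpow0 : 0 ≤ (1 - b) ^ n := pow_nonneg (by linarith) n
    have hpow1 : (1 - b) ^ n ≤ 1 := pow_le_one₀ (by linarith) (by linarith)
    have h1 : (1 - b) ^ (n + 1) * (|Q - R| / (1 + x)) ≤ (1 - b) ^ n * |Q - R| := by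
      have : (1 - b) * (|Q - R| / (1 + x)) ≤ |Q - R| := by
        rw [← mul_div_assoc, div_le_iff₀ hx1]
        nlinarith [abs_nonneg (Q - R)]
      rw [pow_succ, mul_assoc]
      exact mul_le_mul_of_nonneg_left this hpow0
    have h2 : (1 - b) ^ n * |Q - R| ≤ (1 - b) ^ n * |Q| + |R| := by
      have := abs_sub Q R
      nlinarith [abs_nonneg R]
    push_cast
    have : b ^ 3 * (n ^ 2 + n + 1) + (n * b) ^ 3 ≤ ((n + 1) * b) ^ 3 := by
      have : 0 ≤ b ^ 3 := by positivity
      nlinarith [mul_nonneg this hn, mul_nonneg this (sq_nonneg (n:ℝ))]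
    linarith

lemma det_inv_approx {d : ℕ} (B : Matrix (Fin d) (Fin d) ℝ) (hB : B.IsSymm) (b : ℝ)
    (hBb : ‖B‖ ≤ b) (hb : d * b ≤ 1 / 8) (hd : 0 < d) :
    IsUnit (1 + B) ∧ |((1 + B).det)⁻¹ - (1 - B.trace + ((B * B).trace + B.trace ^ 2) / 2)| ≤
      8 / 7 * (d * b) ^ 3 := by
  have hH : B.IsHermitian := by
    rw [IsHermitian, conjTranspose_eq_transpose_of_trivial]; exact hB
  have hb0 : 0 ≤ b := (norm_nonneg _).trans hBb
  have hd1 : (1:ℝ) ≤ d := by exact_mod_cast hd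
  have hb8 : b ≤ 1 / 8 := by nlinarith
  have : Nonempty (Fin d) := ⟨⟨0, hd⟩⟩
  have hev : ∀ i, |hH.eigenvalues i| ≤ b := by
    intro i
    have := spectrum.norm_le_norm_of_mem (hH.eigenvalues_mem_spectrum_real i)
    rw [Real.norm_eq_abs] at this
    exact this.trans hBb
  have hsp : B = hH.eigenvectorUnitary.1 * diagonal hH.eigenvalues * star hH.eigenvectorUnitary.1 := by
    conv_lhs => rw [hH.spectral_theorem, Unitary.conjStarAlgAut_apply]
    rfl
  have hU : star hH.eigenvectorUnitary.1 * hH.eigenvectorUnitary.1 = 1 :=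
    Unitary.coe_star_mul_self _
  have hU' : hH.eigenvectorUnitary.1 * star hH.eigenvectorUnitary.1 = 1 :=
    Unitary.coe_mul_star_self _
  set V := hH.eigenvectorUnitary.1
  set l := hH.eigenvalues
  have htr : B.trace = ∑ i, l i := by
    rw [hsp, trace_mul_comm, ← mul_assoc, hU, one_mul, trace_diagonal]
  have htr2 : (B * B).trace = ∑ i, l i ^ 2 := by
    have : B * B = V * (diagonal l * diagonal l) * star V := by
      conv_lhs => rw [hsp]
      calc _ = V * diagonal l * (star V * V) * diagonal l * star V := by simp only [mul_assoc]
        _ = _ := by rw [hU]; simp only [mul_assoc, one_mul]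
    rw [this, trace_mul_comm, ← mul_assoc, hU, one_mul, diagonal_mul_diagonal, trace_diagonal]
    simp [sq]
  have hdet : (1 + B).det = ∏ i, (1 + l i) := by
    have : 1 + B = V * (1 + diagonal l) * star V := by
      rw [mul_add, add_mul, mul_one, hU', ← hsp]
    rw [this, det_mul_comm, ← mul_assoc, hU, one_mul, ← diagonal_one, diagonal_add, det_diagonal]
  have hpos : 0 < (1 + B).det := by
    rw [hdet]
    exact Finset.prod_pos (fun i _ => by linarith [(abs_le.1 (hev i)).1])
  refine ⟨(isUnit_iff_isUnit_det _).2 hpos.ne'.isUnit, ?_⟩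
  have key := prod_inv_approx l b hb0 (by linarith) Finset.univ (fun i _ => hev i)
  rw [Finset.card_univ, Fintype.card_fin, ← hdet, ← htr, ← htr2] at key
  have hbern : 1 - d * b ≤ (1 - b) ^ d := by
    have := one_add_mul_le_pow (a := -b) (by linarith) d
    rw [← sub_eq_add_neg] at this
    linarith
  have := mul_le_mul_of_nonneg_right (show (7/8 : ℝ) ≤ (1 - b) ^ d by linarith)
    (abs_nonneg (((1 + B).det)⁻¹ - (1 - B.trace + ((B * B).trace + B.trace ^ 2) / 2)))
  linarith

/-- The matrix of an operator. -/
noncomputable def opMat {d : ℕ} (F : EuclideanSpace ℝ (Fin d) →L[ℝ] EuclideanSpace ℝ (Fin d)) :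
    Matrix (Fin d) (Fin d) ℝ := fun i j => F (EuclideanSpace.single j 1) i

lemma toCLM_opMat {d : ℕ} (F : EuclideanSpace ℝ (Fin d) →L[ℝ] EuclideanSpace ℝ (Fin d)) :
    toEuclideanCLM (n := Fin d) (𝕜 := ℝ) (opMat F) = F := by
  apply ContinuousLinearMap.coe_injective
  refine (EuclideanSpace.basisFun (Fin d) ℝ).toBasis.ext fun j => ?_
  ext i
  simp [opMat, ofLp_toEuclideanCLM]

lemma norm_opMat {d : ℕ} (F : EuclideanSpace ℝ (Fin d) →L[ℝ] EuclideanSpace ℝ (Fin d)) :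
    ‖opMat F‖ = ‖F‖ := by
  rw [← l2_opNorm_toEuclideanCLM, toCLM_opMat]

lemma abs_trace_le {d : ℕ} (A : Matrix (Fin d) (Fin d) ℝ) : |A.trace| ≤ d * ‖A‖ := by
  rw [trace]
  refine (Finset.abs_sum_le_sum_abs _ _).trans ?_
  refine (Finset.sum_le_card_nsmul _ _ ‖A‖ (fun i _ => ?_)).trans (by simp)
  have h := (toEuclideanCLM (n := Fin d) (𝕜 := ℝ) A).le_opNorm (EuclideanSpace.single i 1)
  rw [l2_opNorm_toEuclideanCLM] at h
  have h2 := PiLp.norm_apply_le (toEuclideanCLM (n := Fin d) (𝕜 := ℝ) A (EuclideanSpace.single i 1)) i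
  simp [ofLp_toEuclideanCLM] at h h2
  simpa using h2.trans h

/-- The Hessian as an operator. -/
noncomputable def hessOp {d : ℕ} (U : EuclideanSpace ℝ (Fin d) → ℝ) (z : EuclideanSpace ℝ (Fin d)) :
    EuclideanSpace ℝ (Fin d) →L[ℝ] EuclideanSpace ℝ (Fin d) :=
  LinearMap.toContinuousLinearMap
    { toFun := fun v => (InnerProductSpace.toDual ℝ (EuclideanSpace ℝ (Fin d))).symm
        (fderiv ℝ (fderiv ℝ U) z v)
      map_add' := fun v w => by rw [map_add, map_add]
      map_smul' := fun c v => by rw [map_smul, map_smulₛₗ]; rfl }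

lemma hessOp_apply {d : ℕ} (U : EuclideanSpace ℝ (Fin d) → ℝ) (z v : EuclideanSpace ℝ (Fin d)) :
    hessOp U z v = (InnerProductSpace.toDual ℝ (EuclideanSpace ℝ (Fin d))).symm
      (fderiv ℝ (fderiv ℝ U) z v) := rfl

lemma hessMat_symm {d : ℕ} (U : EuclideanSpace ℝ (Fin d) → ℝ) (hU : ContDiff ℝ 3 U)
    (z : EuclideanSpace ℝ (Fin d)) : (hessMat U z).IsSymm := by
  ext i j
  have h : IsSymmSndFDerivAt ℝ U z := hU.contDiffAt.isSymmSndFDerivAt (by simp; norm_num)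
  simp only [transpose_apply, hessMat, iteratedFDeriv_two_apply]
  exact h _ _

lemma hessMat_eq {d : ℕ} (U : EuclideanSpace ℝ (Fin d) → ℝ) (hU : ContDiff ℝ 3 U)
    (z : EuclideanSpace ℝ (Fin d)) : hessMat U z = opMat (hessOp U z) := by
  rw [← hessMat_symm U hU z]
  ext i j
  simp only [transpose_apply, hessMat, iteratedFDeriv_two_apply, opMat, hessOp_apply]
  have := InnerProductSpace.toDual_symm_apply (𝕜 := ℝ) (E := EuclideanSpace ℝ (Fin d))
    (x := EuclideanSpace.single i 1) (y := fderiv ℝ (fderiv ℝ U) z (EuclideanSpace.single j 1))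
  rw [EuclideanSpace.inner_single_right] at this
  simpa using this.symm

lemma norm_hessOp_le {d : ℕ} (U : EuclideanSpace ℝ (Fin d) → ℝ) (z : EuclideanSpace ℝ (Fin d)) :
    ‖hessOp U z‖ ≤ ‖fderiv ℝ (fderiv ℝ U) z‖ := by
  refine ContinuousLinearMap.opNorm_le_bound _ (norm_nonneg _) fun v => ?_
  rw [hessOp_apply, LinearIsometryEquiv.norm_map]
  exact ContinuousLinearMap.le_opNorm _ _

lemma norm_hessOp_sub_le {d : ℕ} (U : EuclideanSpace ℝ (Fin d) → ℝ) (z w : EuclideanSpace ℝ (Fin d)) :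
    ‖hessOp U z - hessOp U w‖ ≤ ‖fderiv ℝ (fderiv ℝ U) z - fderiv ℝ (fderiv ℝ U) w‖ := by
  refine ContinuousLinearMap.opNorm_le_bound _ (norm_nonneg _) fun v => ?_
  rw [_root_.sub_apply, hessOp_apply, hessOp_apply, ← map_sub,
    LinearIsometryEquiv.norm_map, ← _root_.sub_apply]
  exact ContinuousLinearMap.le_opNorm _ _

lemma norm_fderiv2 {E F : Type*} [NormedAddCommGroup E] [NormedSpace ℝ E] [NormedAddCommGroup F]
    [NormedSpace ℝ F] (f : E → F) (z : E) :
    ‖fderiv ℝ (fderiv ℝ f) z‖ = ‖iteratedFDeriv ℝ 2 f z‖ := by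
  rw [← norm_iteratedFDeriv_one, norm_iteratedFDeriv_fderiv]

lemma norm_fderiv3 {E F : Type*} [NormedAddCommGroup E] [NormedSpace ℝ E] [NormedAddCommGroup F]
    [NormedSpace ℝ F] (f : E → F) (z : E) :
    ‖fderiv ℝ (fderiv ℝ (fderiv ℝ f)) z‖ = ‖iteratedFDeriv ℝ 3 f z‖ := by
  rw [norm_fderiv2, norm_iteratedFDeriv_fderiv]

lemma lip_of_fderiv {E F : Type*} [NormedAddCommGroup E] [NormedSpace ℝ E] [NormedAddCommGroup F]
    [NormedSpace ℝ F] (f : E → F) (hf : Differentiable ℝ f) (C : ℝ) (h : ∀ z, ‖fderiv ℝ f z‖ ≤ C)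
    (x y : E) : ‖f y - f x‖ ≤ C * ‖y - x‖ :=
  Convex.norm_image_sub_le_of_norm_fderiv_le (s := Set.univ) (fun z _ => hf z) (fun z _ => h z)
    convex_univ (Set.mem_univ _) (Set.mem_univ _)

lemma taylor2 {E F : Type*} [NormedAddCommGroup E] [NormedSpace ℝ E] [NormedAddCommGroup F]
    [NormedSpace ℝ F] (f : E → F) (hf : Differentiable ℝ f) (hf' : Differentiable ℝ (fderiv ℝ f))
    (C : ℝ) (hC : 0 ≤ C) (h : ∀ z, ‖fderiv ℝ (fderiv ℝ f) z‖ ≤ C)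
    (x y : E) : ‖f y - f x - fderiv ℝ f x (y - x)‖ ≤ C * ‖y - x‖ * ‖y - x‖ := by
  refine Convex.norm_image_sub_le_of_norm_fderiv_le' (s := Metric.closedBall x ‖y - x‖)
    (fun z _ => hf z) (fun z hz => ?_) (convex_closedBall _ _) (by simp) (by simp [dist_eq_norm])
  refine (lip_of_fderiv _ hf' C h x z).trans ?_
  rw [mem_closedBall_iff_norm] at hz
  exact mul_le_mul_of_nonneg_left hz hC

lemma trace_contr {d : ℕ} (T : EuclideanSpace ℝ (Fin d) → EuclideanSpace ℝ (Fin d))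
    (hT : ContDiff ℝ 3 T) (x : EuclideanSpace ℝ (Fin d)) :
    (secondDerivContraction T x).trace = (opMat (fderiv ℝ (fderiv ℝ T) x (T x))).trace := by
  have hs : IsSymmSndFDerivAt ℝ T x := hT.contDiffAt.isSymmSndFDerivAt (by simp; norm_num)
  have hT1 : Differentiable ℝ T := hT.differentiable (by norm_num)
  have hT2 : Differentiable ℝ (fderiv ℝ T) :=
    (hT.fderiv_right (m := 2) (by norm_num)).differentiable (by norm_num)
  simp only [trace, diag_apply, secondDerivContraction, opMat]
  refine Finset.sum_congr rfl fun i _ => ?_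
  have hcomp : ∀ v w, iteratedFDeriv ℝ 2 (fun z => T z i) x ![v, w] =
      (fderiv ℝ (fderiv ℝ T) x v w) i := by
    intro v w
    rw [iteratedFDeriv_two_apply]
    let p : EuclideanSpace ℝ (Fin d) →L[ℝ] ℝ := EuclideanSpace.proj i
    have e1 : fderiv ℝ (fun z => T z i) = fun z => p ∘L fderiv ℝ T z := by
      funext z
      exact (p.hasFDerivAt.comp z (hT1 z).hasFDerivAt).fderiv
    have e2 : HasFDerivAt (fun z => p ∘L fderiv ℝ T z)
        ((ContinuousLinearMap.compL ℝ _ _ _ p) ∘L fderiv ℝ (fderiv ℝ T) x) x :=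
      (ContinuousLinearMap.compL ℝ (EuclideanSpace ℝ (Fin d)) (EuclideanSpace ℝ (Fin d)) ℝ
        p).hasFDerivAt.comp x (hT2 x).hasFDerivAt
    rw [e1, e2.fderiv]
    rfl
  simp only [hcomp]
  rw [hs (T x)]
  have hx : T x = ∑ k, T x k • (EuclideanSpace.single k (1:ℝ)) := by
    have := (EuclideanSpace.basisFun (Fin d) ℝ).sum_repr (T x)
    simpa using this.symm
  conv_rhs => rw [hx, map_sum]
  simp [mul_comm]

set_option maxHeartbeats 4000000 in
lemma main_aux {d : ℕ} (hd : 0 < d) (U : EuclideanSpace ℝ (Fin d) → ℝ)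
    (L : ℝ) (hL : 0 < L) (hU : ContDiff ℝ 3 U)
    (hgrad0 : gradient U 0 = 0)
    (hHess : ∀ z, ‖iteratedFDeriv ℝ 2 U z‖ ≤ L)
    (hD3U : ∀ z, ‖iteratedFDeriv ℝ 3 U z‖ ≤ L)
    (T : EuclideanSpace ℝ (Fin d) → EuclideanSpace ℝ (Fin d))
    (hT : ContDiff ℝ 3 T)
    (hJsymm : ∀ z, (jacMat T z).IsSymm)
    (hT0 : ∀ z, ‖T z‖ ≤ Real.sqrt L * (‖z‖ + 1))
    (hT1 : ∀ z, ‖fderiv ℝ T z‖ ≤ Real.sqrt L)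
    (hT2 : ∀ z, ‖iteratedFDeriv ℝ 2 T z‖ ≤ Real.sqrt L)
    (hT3 : ∀ z, ‖iteratedFDeriv ℝ 3 T z‖ ≤ Real.sqrt L)
    (δ : ℝ) (hδ0 : 0 < δ) (hδ : δ ≤ 1 / (2 ^ 8 * d ^ 2 * L))
    (x y : EuclideanSpace ℝ (Fin d))
    (hxy : x = y - δ • gradient U y + Real.sqrt (2 * δ) • T y) :
    IsUnit (1 - δ • hessMat U y + Real.sqrt (2 * δ) • jacMat T y) ∧
      |((1 - δ • hessMat U y + Real.sqrt (2 * δ) • jacMat T y).det)⁻¹ -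
          (1 - Real.sqrt (2 * δ) * (jacMat T x).trace +
            2 * δ * (secondDerivContraction T x).trace +
            δ * (hessMat U x).trace + δ * (jacMat T x).trace ^ 2 +
            δ * (jacMat T x * jacMat T x).trace)| ≤
        128 * (δ * Real.sqrt δ) * (d : ℝ) ^ 3 * (L * Real.sqrt L) * (‖x‖ ^ 2 + 1) := by
  -- derivative facts
  have dT : Differentiable ℝ T := hT.differentiable (by norm_num)
  have cT : ContDiff ℝ 2 (fderiv ℝ T) := hT.fderiv_right (by norm_num)
  have dT2 : Differentiable ℝ (fderiv ℝ T) := cT.differentiable (by norm_num)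
  have dT3 : Differentiable ℝ (fderiv ℝ (fderiv ℝ T)) :=
    (cT.fderiv_right (m := 1) (by norm_num)).differentiable (by norm_num)
  have cU : ContDiff ℝ 2 (fderiv ℝ U) := hU.fderiv_right (by norm_num)
  have dU2 : Differentiable ℝ (fderiv ℝ U) := cU.differentiable (by norm_num)
  have dU3 : Differentiable ℝ (fderiv ℝ (fderiv ℝ U)) :=
    (cU.fderiv_right (m := 1) (by norm_num)).differentiable (by norm_num)
  have hgrad : ‖gradient U y‖ ≤ L * ‖y‖ := by
    have h := lip_of_fderiv _ dU2 L (fun z => by rw [norm_fderiv2]; exact hHess z) 0 y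
    have h0 : fderiv ℝ U 0 = 0 := by
      rw [gradient] at hgrad0
      simpa using hgrad0
    rw [h0, sub_zero, sub_zero] at h
    rw [gradient, LinearIsometryEquiv.norm_map]
    exact h
  have lipT := lip_of_fderiv _ dT _ hT1 x y
  have lipJ := lip_of_fderiv _ dT2 (√L) (fun z => by rw [norm_fderiv2]; exact hT2 z) x y
  have tayJ := taylor2 _ dT2 dT3 (√L) (Real.sqrt_nonneg _)
    (fun z => by rw [norm_fderiv3]; exact hT3 z) x y
  have lipH := lip_of_fderiv _ dU3 L (fun z => by rw [norm_fderiv3]; exact hD3U z) x y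
  have hDD : ‖fderiv ℝ (fderiv ℝ T) x‖ ≤ √L := by rw [norm_fderiv2]; exact hT2 x
  -- scalars
  have ht2 : √δ ^ 2 = δ := Real.sq_sqrt hδ0.le
  have hl2 : √L ^ 2 = L := Real.sq_sqrt hL.le
  have hs2 : √(2 * δ) ^ 2 = 2 * δ := Real.sq_sqrt (by positivity)
  have ht0 : 0 < √δ := Real.sqrt_pos.2 hδ0
  have hl0 : 0 < √L := Real.sqrt_pos.2 hL
  have hs0 : 0 < √(2 * δ) := Real.sqrt_pos.2 (by positivity)
  have hst : √(2 * δ) ≤ 3 / 2 * √δ := by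
    apply Real.sqrt_le_iff.2
    constructor
    · positivity
    · rw [mul_pow, ht2]; linarith
  have hd1 : (1:ℝ) ≤ d := by exact_mod_cast hd
  set s := √(2 * δ)
  set t := √δ
  set l := √L
  obtain ⟨ε, hε⟩ : ∃ ε, ε = t * l := ⟨_, rfl⟩
  have hε0 : 0 < ε := by rw [hε]; positivity
  have hε2 : δ * L = ε ^ 2 := by rw [hε, mul_pow, ht2, hl2]
  have hsl : s * l ≤ 3 / 2 * ε := by
    rw [hε, ← mul_assoc]; exact mul_le_mul_of_nonneg_right hst hl0.le
  have hεd : d * ε ≤ 1 / 16 := by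
    have h : (d * ε) ^ 2 ≤ (1 / 16) ^ 2 := by
      rw [mul_pow, ← hε2]
      rw [le_div_iff₀ (by positivity)] at hδ
      linarith
    exact le_of_sq_le_sq h (by norm_num)
  have hε16 : ε ≤ 1 / 16 := (le_mul_of_one_le_left hε0.le hd1).trans hεd
  obtain ⟨r, hr⟩ : ∃ r, r = ‖x‖ + 1 := ⟨_, rfl⟩
  have hr1 : 1 ≤ r := by rw [hr]; linarith [norm_nonneg x]
  obtain ⟨D, hD⟩ : ∃ D, D = ‖y - x‖ := ⟨_, rfl⟩
  have hD0 : 0 ≤ D := by rw [hD]; positivity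
  have hδg : ‖δ • gradient U y‖ ≤ ε ^ 2 * ‖y‖ := by
    rw [norm_smul, Real.norm_eq_abs, abs_of_pos hδ0, ← hε2, mul_assoc]
    exact mul_le_mul_of_nonneg_left hgrad hδ0.le
  have hD1 : D ≤ ε ^ 2 * ‖y‖ + 3 / 2 * ε * (‖y‖ + 1) := by
    have e : y - x = δ • gradient U y - s • T y := by rw [hxy]; abel
    rw [hD, e]
    refine (norm_sub_le _ _).trans (add_le_add hδg ?_)
    rw [norm_smul, Real.norm_eq_abs, abs_of_pos hs0]
    calc s * ‖T y‖ ≤ s * (l * (‖y‖ + 1)) := mul_le_mul_of_nonneg_left (hT0 y) hs0.le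
      _ = (s * l) * (‖y‖ + 1) := by ring
      _ ≤ _ := mul_le_mul_of_nonneg_right hsl (by positivity)
  have hyx : ‖y‖ ≤ ‖x‖ + D := by
    rw [hD]; have := norm_add_le x (y - x); rwa [add_sub_cancel] at this
  have hy0 := norm_nonneg y
  have hD2 : D ≤ 25 / 16 * ε * (‖y‖ + 1) := by
    have h1 : ε ^ 2 ≤ 1 / 16 * ε := by
      rw [sq]; exact mul_le_mul_of_nonneg_right hε16 hε0.le
    have h2 : ε ^ 2 * ‖y‖ ≤ 1 / 16 * ε * ‖y‖ := mul_le_mul_of_nonneg_right h1 hy0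
    linarith
  have hy1 : ‖y‖ + 1 ≤ 28 / 25 * r := by
    have h1 : ε * (‖y‖ + 1) ≤ 1 / 16 * (‖y‖ + 1) :=
      mul_le_mul_of_nonneg_right hε16 (by positivity)
    linarith
  have hDr : D ≤ 7 / 4 * ε * r := by
    have h1 : ε * (‖y‖ + 1) ≤ ε * (28 / 25 * r) := mul_le_mul_of_nonneg_left hy1 hε0.le
    have h2 : 0 ≤ ε * r := by positivity
    linarith
  obtain ⟨w, hw⟩ : ∃ w, w = y - x + s • T x := ⟨_, rfl⟩
  have hwn : ‖w‖ ≤ 4 * ε ^ 2 * r := by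
    have e : w = δ • gradient U y - s • (T y - T x) := by
      rw [hw, smul_sub]; nth_rw 1 [hxy]; abel
    rw [e]
    have h1 : ‖s • (T y - T x)‖ ≤ 3 / 2 * ε * D := by
      rw [norm_smul, Real.norm_eq_abs, abs_of_pos hs0]
      calc s * ‖T y - T x‖ ≤ s * (l * D) := by
            rw [hD]; exact mul_le_mul_of_nonneg_left lipT hs0.le
        _ = (s * l) * D := by ring
        _ ≤ _ := mul_le_mul_of_nonneg_right hsl hD0
    have h2 := norm_sub_le (δ • gradient U y) (s • (T y - T x))
    have h3 : ε ^ 2 * ‖y‖ ≤ ε ^ 2 * (28 / 25 * r) :=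
      mul_le_mul_of_nonneg_left (by linarith) (by positivity)
    have h4 : 3 / 2 * ε * D ≤ 3 / 2 * ε * (7 / 4 * ε * r) :=
      mul_le_mul_of_nonneg_left hDr (by positivity)
    have h5 : 0 ≤ ε ^ 2 * r := by positivity
    linarith
  -- matrices
  rw [trace_contr T hT x]
  obtain ⟨A0, hA0⟩ : ∃ A, A = jacMat T x := ⟨_, rfl⟩
  obtain ⟨A1, hA1⟩ : ∃ A, A = jacMat T y := ⟨_, rfl⟩
  obtain ⟨H0, hH0⟩ : ∃ A, A = hessMat U x := ⟨_, rfl⟩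
  obtain ⟨H1, hH1⟩ : ∃ A, A = hessMat U y := ⟨_, rfl⟩
  have nA0 : ‖A0‖ ≤ l := by rw [hA0]; exact (norm_opMat (fderiv ℝ T x)).trans_le (hT1 x)
  have nA1 : ‖A1‖ ≤ l := by rw [hA1]; exact (norm_opMat (fderiv ℝ T y)).trans_le (hT1 y)
  have nA : ‖A1 - A0‖ ≤ l * D := by
    rw [hA1, hA0, hD]
    exact (norm_opMat (fderiv ℝ T y - fderiv ℝ T x)).trans_le lipJ
  have nH1 : ‖H1‖ ≤ L := by
    rw [hH1, hessMat_eq U hU, norm_opMat]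
    exact (norm_hessOp_le U y).trans (by rw [norm_fderiv2]; exact hHess y)
  have nH : ‖H1 - H0‖ ≤ L * D := by
    rw [hH1, hH0, hessMat_eq U hU, hessMat_eq U hU, hD]
    exact (norm_opMat (hessOp U y - hessOp U x)).trans_le ((norm_hessOp_sub_le U y x).trans lipH)
  obtain ⟨N, hN⟩ : ∃ N, N = opMat (fderiv ℝ (fderiv ℝ T) x (T x)) := ⟨_, rfl⟩
  have tE2 : |s * (A1.trace - A0.trace) + 2 * δ * N.trace| ≤ s * (d * (l * D * D) + d * (l * ‖w‖)) := by
    have e : s * (A1.trace - A0.trace) + 2 * δ * N.trace =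
        s * ((opMat (fderiv ℝ T y - fderiv ℝ T x - fderiv ℝ (fderiv ℝ T) x (y - x))).trace
          + (opMat (fderiv ℝ (fderiv ℝ T) x w)).trace) := by
      rw [← hs2, hN, hA1, hA0, hw]
      simp only [trace, diag_apply, opMat, jacMat, map_add, map_smul, _root_.sub_apply,
        _root_.add_apply, _root_.smul_apply, PiLp.add_apply, PiLp.sub_apply,
        PiLp.smul_apply, Finset.sum_add_distrib, Finset.sum_sub_distrib, smul_eq_mul, ← Finset.mul_sum]
      ring
    rw [e, abs_mul, abs_of_pos hs0]
    refine mul_le_mul_of_nonneg_left ((abs_add_le _ _).trans (add_le_add ?_ ?_)) hs0.le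
    · refine (abs_trace_le _).trans (mul_le_mul_of_nonneg_left ?_ (by positivity))
      rw [norm_opMat, hD]; exact tayJ
    · refine (abs_trace_le _).trans (mul_le_mul_of_nonneg_left ?_ (by positivity))
      rw [norm_opMat]
      exact (ContinuousLinearMap.le_opNorm _ _).trans (mul_le_mul_of_nonneg_right hDD (norm_nonneg _))
  have hJs := hJsymm y
  have hHs := hessMat_symm U hU y
  rw [← hA0, ← hA1, ← hH0, ← hH1, ← hN]
  rw [← hA1] at hJs
  rw [← hH1] at hHs
  clear hA0 hA1 hH0 hH1 hN
  have hB : (s • A1 - δ • H1).IsSymm := (hJs.smul s).sub (hHs.smul δ)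
  have hBn : ‖s • A1 - δ • H1‖ ≤ 25 / 16 * ε := by
    refine (norm_sub_le _ _).trans ?_
    rw [norm_smul, norm_smul, Real.norm_eq_abs, Real.norm_eq_abs, abs_of_pos hs0, abs_of_pos hδ0]
    have h1 := mul_le_mul_of_nonneg_left nA1 hs0.le
    have h2 := mul_le_mul_of_nonneg_left nH1 hδ0.le
    have h3 : ε ^ 2 ≤ 1 / 16 * ε := by
      rw [sq]; exact mul_le_mul_of_nonneg_right hε16 hε0.le
    linarith
  obtain ⟨hu, hdet⟩ := det_inv_approx _ hB _ hBn (by linarith) hd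
  have e1 : 1 - δ • H1 + s • A1 = 1 + (s • A1 - δ • H1) := by abel
  rw [e1]
  refine ⟨hu, ?_⟩
  have etr : (s • A1 - δ • H1).trace = s * A1.trace - δ * H1.trace := by
    simp [trace_sub, trace_smul]
  have etr2 : ((s • A1 - δ • H1) * (s • A1 - δ • H1)).trace =
      2 * δ * (A1 * A1).trace - 2 * s * δ * (A1 * H1).trace + δ ^ 2 * (H1 * H1).trace := by
    rw [← hs2]
    simp only [sub_mul, mul_sub, trace_sub, smul_mul_assoc, mul_smul_comm, trace_smul, smul_eq_mul]
    rw [trace_mul_comm H1 A1]; ring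
  rw [etr, etr2] at hdet
  -- trace bounds
  have hdn : (0:ℝ) ≤ d := by positivity
  have ta1 : |A1.trace| ≤ d * l := (abs_trace_le _).trans (mul_le_mul_of_nonneg_left nA1 hdn)
  have ta0 : |A0.trace| ≤ d * l := (abs_trace_le _).trans (mul_le_mul_of_nonneg_left nA0 hdn)
  have th1 : |H1.trace| ≤ d * L := (abs_trace_le _).trans (mul_le_mul_of_nonneg_left nH1 hdn)
  have ta : |A1.trace - A0.trace| ≤ d * (l * D) := by
    rw [← trace_sub]; exact (abs_trace_le _).trans (mul_le_mul_of_nonneg_left nA hdn)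
  have th : |H1.trace - H0.trace| ≤ d * (L * D) := by
    rw [← trace_sub]; exact (abs_trace_le _).trans (mul_le_mul_of_nonneg_left nH hdn)
  have tmul : ∀ (P Q : Matrix (Fin d) (Fin d) ℝ) (p q : ℝ), ‖P‖ ≤ p → ‖Q‖ ≤ q →
      |(P * Q).trace| ≤ d * (p * q) := by
    intro P Q p q hp hq
    refine (abs_trace_le _).trans (mul_le_mul_of_nonneg_left ((norm_mul_le _ _).trans ?_) hdn)
    exact mul_le_mul hp hq (norm_nonneg _) ((norm_nonneg _).trans hp)
  have tc := tmul A1 H1 _ _ nA1 nH1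
  have tk := tmul H1 H1 _ _ nH1 nH1
  have tq : |(A1 * A1).trace - (A0 * A0).trace| ≤ 2 * (d * (l * D * l)) := by
    have e : (A1 * A1).trace - (A0 * A0).trace = ((A1 - A0) * A1).trace + ((A1 - A0) * A0).trace := by
      simp only [sub_mul, trace_sub]; rw [trace_mul_comm A0 A1]; ring
    rw [e]
    have h1 := tmul _ _ _ _ nA nA1
    have h2 := tmul _ _ _ _ nA nA0
    have := abs_add_le ((A1 - A0) * A1).trace ((A1 - A0) * A0).trace
    linarith
  have tasq : |A1.trace ^ 2 - A0.trace ^ 2| ≤ d * (l * D) * (2 * (d * l)) := by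
    rw [show A1.trace ^ 2 - A0.trace ^ 2 = (A1.trace - A0.trace) * (A1.trace + A0.trace) by ring,
      abs_mul]
    refine mul_le_mul ta ((abs_add_le _ _).trans (by linarith)) (abs_nonneg _) (by positivity)
  have tah : |A1.trace * H1.trace| ≤ (d * l) * (d * L) := by
    rw [abs_mul]; exact mul_le_mul ta1 th1 (abs_nonneg _) (by positivity)
  have thh : |H1.trace ^ 2| ≤ (d * L) ^ 2 := by
    rw [abs_pow]; exact pow_le_pow_left₀ (abs_nonneg _) th1 2
  generalize A1.trace = a1 at *
  generalize A0.trace = a0 at *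
  generalize H1.trace = h1 at *
  generalize H0.trace = h0 at *
  generalize N.trace = m at *
  generalize (A1 * A1).trace = q1 at *
  generalize (A0 * A0).trace = q0 at *
  generalize (A1 * H1).trace = c at *
  generalize (H1 * H1).trace = k at *
  generalize ((1 + (s • A1 - δ • H1)).det)⁻¹ = v at *
  -- final estimate
  obtain ⟨W, hW⟩ : ∃ W, W = ε ^ 3 * d ^ 3 * r ^ 2 := ⟨_, rfl⟩
  have mono : ∀ i j : ℕ, i ≤ 3 → j ≤ 2 → ε ^ 3 * d ^ i * r ^ j ≤ W := by
    intro i j hi hj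
    rw [hW]
    have := pow_le_pow_right₀ hd1 hi
    have := pow_le_pow_right₀ hr1 hj
    gcongr
  have F1 : |v - (1 - (s * a1 - δ * h1) + (2 * δ * q1 - 2 * s * δ * c + δ ^ 2 * k +
      (s * a1 - δ * h1) ^ 2) / 2)| ≤ 5 * W := by
    refine hdet.trans ?_
    have := mono 3 0 le_rfl (by norm_num)
    have e : 8 / 7 * ((d:ℝ) * (25 / 16 * ε)) ^ 3 = 8 / 7 * (25 / 16) ^ 3 * (ε ^ 3 * d ^ 3 * r ^ 0) := by ring
    rw [e]
    have : 0 ≤ W := by rw [hW]; positivity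
    linarith
  have F2 : |s * (a1 - a0) + 2 * δ * m| ≤ 12 * W := by
    refine tE2.trans ?_
    calc s * (d * (l * D * D) + d * (l * ‖w‖)) = (s * l) * (d * (D * D + ‖w‖)) := by ring
      _ ≤ (3 / 2 * ε) * (d * ((7 / 4 * ε * r) * (7 / 4 * ε * r) + 4 * ε ^ 2 * r)) := by
        gcongr
      _ = 147 / 32 * (ε ^ 3 * d ^ 1 * r ^ 2) + 6 * (ε ^ 3 * d ^ 1 * r ^ 1) := by ring
      _ ≤ 12 * W := by
        have := mono 1 2 (by norm_num) (by norm_num)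
        have := mono 1 1 (by norm_num) (by norm_num)
        have : 0 ≤ W := by rw [hW]; positivity
        linarith
  have F3 : |δ * (h1 - h0)| ≤ 2 * W := by
    rw [abs_mul, abs_of_pos hδ0]
    calc δ * |h1 - h0| ≤ δ * (d * (L * D)) := by gcongr
      _ = (δ * L) * d * D := by ring
      _ ≤ ε ^ 2 * d * (7 / 4 * ε * r) := by rw [hε2]; gcongr
      _ = 7 / 4 * (ε ^ 3 * d ^ 1 * r ^ 1) := by ring
      _ ≤ 2 * W := by
        have := mono 1 1 (by norm_num) (by norm_num)
        have : 0 ≤ W := by rw [hW]; positivity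
        linarith
  have F4 : |δ * (q1 - q0)| ≤ 4 * W := by
    rw [abs_mul, abs_of_pos hδ0]
    calc δ * |q1 - q0| ≤ δ * (2 * (d * (l * D * l))) := by gcongr
      _ = (δ * l ^ 2) * 2 * d * D := by ring
      _ ≤ ε ^ 2 * 2 * d * (7 / 4 * ε * r) := by rw [hl2, hε2]; gcongr
      _ = 7 / 2 * (ε ^ 3 * d ^ 1 * r ^ 1) := by ring
      _ ≤ 4 * W := by
        have := mono 1 1 (by norm_num) (by norm_num)
        have : 0 ≤ W := by rw [hW]; positivity
        linarith
  have F5 : |δ * (a1 ^ 2 - a0 ^ 2)| ≤ 4 * W := by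
    rw [abs_mul, abs_of_pos hδ0]
    calc δ * |a1 ^ 2 - a0 ^ 2| ≤ δ * (d * (l * D) * (2 * (d * l))) := by gcongr
      _ = (δ * l ^ 2) * 2 * d ^ 2 * D := by ring
      _ ≤ ε ^ 2 * 2 * d ^ 2 * (7 / 4 * ε * r) := by rw [hl2, hε2]; gcongr
      _ = 7 / 2 * (ε ^ 3 * d ^ 2 * r ^ 1) := by ring
      _ ≤ 4 * W := by
        have := mono 2 1 (by norm_num) (by norm_num)
        have : 0 ≤ W := by rw [hW]; positivity
        linarith
  have F6 : |s * δ * c| ≤ 2 * W := by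
    rw [abs_mul, abs_of_pos (by positivity)]
    calc s * δ * |c| ≤ s * δ * (d * (l * L)) := by gcongr
      _ = (s * l) * (δ * L) * d := by ring
      _ ≤ (3 / 2 * ε) * ε ^ 2 * d := by rw [hε2]; gcongr
      _ = 3 / 2 * (ε ^ 3 * d ^ 1 * r ^ 0) := by ring
      _ ≤ 2 * W := by
        have := mono 1 0 (by norm_num) (by norm_num)
        have : 0 ≤ W := by rw [hW]; positivity
        linarith
  have F7 : |s * δ * (a1 * h1)| ≤ 2 * W := by
    rw [abs_mul, abs_of_pos (by positivity)]
    calc s * δ * |a1 * h1| ≤ s * δ * ((d * l) * (d * L)) := by gcongr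
      _ = (s * l) * (δ * L) * d ^ 2 := by ring
      _ ≤ (3 / 2 * ε) * ε ^ 2 * d ^ 2 := by rw [hε2]; gcongr
      _ = 3 / 2 * (ε ^ 3 * d ^ 2 * r ^ 0) := by ring
      _ ≤ 2 * W := by
        have := mono 2 0 (by norm_num) (by norm_num)
        have : 0 ≤ W := by rw [hW]; positivity
        linarith
  have F8 : |δ ^ 2 * k| ≤ W := by
    rw [abs_mul, abs_of_pos (by positivity)]
    calc δ ^ 2 * |k| ≤ δ ^ 2 * (d * (L * L)) := by gcongr
      _ = (δ * L) ^ 2 * d := by ring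
      _ = ε ^ 3 * d * ε := by rw [hε2]; ring
      _ ≤ ε ^ 3 * d * 1 := by gcongr; linarith
      _ = (ε ^ 3 * d ^ 1 * r ^ 0) := by ring
      _ ≤ W := mono 1 0 (by norm_num) (by norm_num)
  have F9 : |δ ^ 2 * h1 ^ 2| ≤ W := by
    rw [abs_mul, abs_of_pos (by positivity)]
    calc δ ^ 2 * |h1 ^ 2| ≤ δ ^ 2 * ((d * L) ^ 2) := by gcongr
      _ = (δ * L) ^ 2 * d ^ 2 := by ring
      _ = ε ^ 3 * d ^ 2 * ε := by rw [hε2]; ring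
      _ ≤ ε ^ 3 * d ^ 2 * 1 := by gcongr; linarith
      _ = (ε ^ 3 * d ^ 2 * r ^ 0) := by ring
      _ ≤ W := mono 2 0 (by norm_num) (by norm_num)
  have hfin : 64 * W ≤ 128 * (δ * t) * (d : ℝ) ^ 3 * (L * l) * (‖x‖ ^ 2 + 1) := by
    have e : 128 * (δ * t) * (d : ℝ) ^ 3 * (L * l) * (‖x‖ ^ 2 + 1) =
        64 * (ε ^ 3 * d ^ 3 * (2 * (‖x‖ ^ 2 + 1))) := by
      calc _ = 128 * ((δ * L) * (t * l)) * (d : ℝ) ^ 3 * (‖x‖ ^ 2 + 1) := by ring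
        _ = _ := by rw [hε2, ← hε]; ring
    rw [e, hW]
    have : r ^ 2 ≤ 2 * (‖x‖ ^ 2 + 1) := by
      rw [hr]; have := sq_nonneg (‖x‖ - 1); linarith
    gcongr
  refine le_trans ?_ hfin
  have W0 : 0 ≤ W := by rw [hW]; positivity
  have ident : (s * a1 - δ * h1) ^ 2 = 2 * δ * a1 ^ 2 - 2 * (s * δ * (a1 * h1)) + δ ^ 2 * h1 ^ 2 := by
    rw [← hs2]; ring
  rw [ident] at F1
  rw [abs_le] at *
  constructor <;> linarith [F1.1, F2.1, F3.1, F4.1, F5.1, F6.1, F7.1, F8.1, F9.1, F1.2, F2.2, F3.2, F4.2, F5.2, F6.2, F7.2, F8.2, F9.2]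

end aux
theorem stmt14 {d : ℕ} (hd : 0 < d) (U : EuclideanSpace ℝ (Fin d) → ℝ)
    (L : ℝ) (hL : 0 < L) (hU : ContDiff ℝ 3 U)
    (hgrad0 : gradient U 0 = 0)
    (hHess : ∀ z, ‖iteratedFDeriv ℝ 2 U z‖ ≤ L)
    (hD3U : ∀ z, ‖iteratedFDeriv ℝ 3 U z‖ ≤ L)
    (T : EuclideanSpace ℝ (Fin d) → EuclideanSpace ℝ (Fin d))
    (hT : ContDiff ℝ 3 T)
    (hJsymm : ∀ z, (jacMat T z).IsSymm)
    (hT0 : ∀ z, ‖T z‖ ≤ Real.sqrt L * (‖z‖ + 1))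
    (hT1 : ∀ z, ‖fderiv ℝ T z‖ ≤ Real.sqrt L)
    (hT2 : ∀ z, ‖iteratedFDeriv ℝ 2 T z‖ ≤ Real.sqrt L)
    (hT3 : ∀ z, ‖iteratedFDeriv ℝ 3 T z‖ ≤ Real.sqrt L)
    (δ : ℝ) (hδ0 : 0 < δ) (hδ : δ ≤ 1 / (2 ^ 8 * d ^ 2 * L))
    (x y : EuclideanSpace ℝ (Fin d))
    (hxy : x = y - δ • gradient U y + Real.sqrt (2 * δ) • T y) :
    IsUnit (1 - δ • hessMat U y + Real.sqrt (2 * δ) • jacMat T y) ∧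
      |((1 - δ • hessMat U y + Real.sqrt (2 * δ) • jacMat T y).det)⁻¹ -
          (1 - Real.sqrt (2 * δ) * (jacMat T x).trace +
            2 * δ * (secondDerivContraction T x).trace +
            δ * (hessMat U x).trace + δ * (jacMat T x).trace ^ 2 +
            δ * (jacMat T x * jacMat T x).trace)| ≤
        128 * (δ * Real.sqrt δ) * (d : ℝ) ^ 3 * (L * Real.sqrt L) * (‖x‖ ^ 2 + 1) := by
  exact main_aux hd U L hL hU hgrad0 hHess hD3U T hT hJsymm hT0 hT1 hT2 hT3 δ hδ0 hδ x y hxy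
end

section
/- Let 0 < δ ≤ 1/(2^8 · d² · L) and let x, y ∈ ℝ^d satisfy x = y − δ∇U(y) + √(2δ)·T(y). Then the matrix I − δ∇²U(y) + √(2δ)·DT(y) is invertible and |det(I − δ∇²U(y) + √(2δ)·DT(y))^{-1} − (1 − √(2δ)·tr(DT(x)))| ≤ 8·δ·d²·L·(‖x‖₂² + 1). -/
open Finset in
lemma aux_prod {ι : Type*} (l : ι → ℝ) (b : ℝ) (hb0 : 0 ≤ b) (hb1 : b < 1)
    (hl : ∀ i, |l i| ≤ b) (s : Finset ι) :
    |∏ i ∈ s, (1 + l i)⁻¹ - 1| ≤ ((1 - b)⁻¹) ^ s.card - 1 ∧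
    |∏ i ∈ s, (1 + l i)⁻¹ - 1 + ∑ i ∈ s, l i| ≤ ((1 - b)⁻¹) ^ s.card - 1 - s.card * b := by
  classical
  induction s using Finset.induction_on with
  | empty => simp
  | insert a s ha ih =>
    obtain ⟨ih1, ih2⟩ := ih
    rw [Finset.prod_insert ha, Finset.sum_insert ha, Finset.card_insert_of_notMem ha]
    set Q := ∏ i ∈ s, (1 + l i)⁻¹
    set S := ∑ i ∈ s, l i
    set G := ((1 - b)⁻¹) ^ s.card with hG
    have h1b : 0 < 1 - b := by linarith
    have hla := abs_le.mp (hl a)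
    have hpos : 0 < 1 + l a := by linarith
    set g := (1 - b)⁻¹ with hg
    have hgg : g * (1 - b) = 1 := inv_mul_cancel₀ h1b.ne'
    have hg1 : 0 < g := inv_pos.mpr h1b
    obtain ⟨r, hr⟩ : ∃ r, r = (1 + l a)⁻¹ - 1 := ⟨_, rfl⟩
    have hr' : (1 + l a)⁻¹ = 1 + r := by linarith
    have hrr : (1 + r) * (1 + l a) = 1 := by rw [← hr']; exact inv_mul_cancel₀ hpos.ne'
    have hle : 1 + r ≤ g := by
      rw [← hr']; exact inv_anti₀ h1b (by linarith)
    have h0r : 0 < 1 + r := by rw [← hr']; exact inv_pos.mpr hpos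
    have hrb : |r| ≤ g - 1 := by
      have e1 : r = -(1 + r) * l a := by linarith
      have e2 : g - 1 = g * b := by linarith
      rw [e2, e1, abs_mul, abs_neg, abs_of_pos h0r]
      exact mul_le_mul hle (hl a) (abs_nonneg _) hg1.le
    have hrl : |r + l a| ≤ g - 1 - b := by
      have e1 : r + l a = (1 + r) * (l a * l a) := by linear_combination (1 - l a) * hrr
      have e2 : g - 1 - b = g * (b * b) := by linear_combination (1 + b) * hgg
      rw [e2, e1, abs_mul, abs_mul, abs_of_pos h0r]
      exact mul_le_mul hle (mul_le_mul (hl a) (hl a) (abs_nonneg _) hb0) (by positivity) hg1.le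
    have hG1 : 0 ≤ G - 1 := le_trans (abs_nonneg _) ih1
    have hQr : |(Q - 1) * r| ≤ (G - 1) * (g - 1) := by
      rw [abs_mul]; exact mul_le_mul ih1 hrb (abs_nonneg _) hG1
    have hpow : g ^ (s.card + 1) = G * g := by rw [pow_succ]
    rw [hpow, hr']
    push_cast
    constructor
    · have : (1 + r) * Q - 1 = (Q - 1) + r + (Q - 1) * r := by ring
      rw [this]
      refine (abs_add_three _ _ _).trans ?_
      linarith
    · have : (1 + r) * Q - 1 + (l a + S) = (Q - 1 + S) + (r + l a) + (Q - 1) * r := by ring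
      rw [this]
      refine (abs_add_three _ _ _).trans ?_
      linarith

lemma aux_prod2 {ι : Type*} [Fintype ι] (l : ι → ℝ) (b : ℝ) (hb0 : 0 ≤ b) (hb1 : b < 1)
    (hdb : (Fintype.card ι : ℝ) * b < 1)
    (hl : ∀ i, |l i| ≤ b) :
    |(∏ i, (1 + l i))⁻¹ - 1 + ∑ i, l i| ≤
      (1 - Fintype.card ι * b)⁻¹ - 1 - Fintype.card ι * b := by
  have h := (aux_prod l b hb0 hb1 hl Finset.univ).2
  rw [Finset.prod_inv_distrib] at h
  refine h.trans ?_
  have h2 := one_add_mul_le_pow (a := -b) (by linarith) (Fintype.card ι)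
  have h3 : ((1 - b)⁻¹) ^ (Fintype.card ι) ≤ (1 - Fintype.card ι * b)⁻¹ := by
    rw [inv_pow]
    apply inv_anti₀ (by linarith)
    calc _ = 1 + (Fintype.card ι : ℝ) * -b := by ring
      _ ≤ _ := h2
      _ = _ := by ring
  rw [Finset.card_univ]
  linarith

lemma aux_final (D a b u r E : ℝ) (hD : 1 ≤ D) (ha : 0 < a) (hp : (a * D) ^ 2 ≤ 1 / 128)
    (hb : b = a + a ^ 2 / 2) (hu : 0 ≤ u) (hr0 : 0 ≤ r) (hr : r ≤ b * (u + r) + a)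
    (hE : E ≤ ((1 - D * b)⁻¹ - 1 - D * b) + a ^ 2 / 2 * D + a * D * r) :
    E ≤ 4 * a ^ 2 * D ^ 2 * (u ^ 2 + 1) := by
  have hp' : a * D ≤ 0.09 := by
    by_contra h
    push Not at h
    nlinarith
  have ha' : a ≤ 0.09 := by nlinarith
  have hb1 : b ≤ 1.045 * a := by rw [hb]; nlinarith
  have hb0 : 0 < b := by rw [hb]; positivity
  have hDb : D * b ≤ 1.045 * (a * D) := by nlinarith
  have hDb0 : 0 < D * b := by positivity
  have hDb1 : D * b ≤ 0.095 := by linarith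
  have e1 : (1 - D * b)⁻¹ - 1 - D * b ≤ 1.11 * (D * b) ^ 2 := by
    have : (1 - D * b)⁻¹ ≤ 1 + D * b + 1.11 * (D * b) ^ 2 := by
      rw [inv_le_iff_one_le_mul₀ (by linarith)]
      nlinarith [mul_nonneg (sq_nonneg (D*b)) (by linarith : (0:ℝ) ≤ 0.095 - D * b), sq_nonneg (D*b)]
    linarith
  have e2 : (D * b) ^ 2 ≤ 1.1 * (a * D) ^ 2 := by
    have := pow_le_pow_left₀ hDb0.le hDb 2
    nlinarith [sq_nonneg (a*D)]
  have e3 : a ^ 2 / 2 * D ≤ (a * D) ^ 2 / 2 := by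
    have : D ≤ D ^ 2 := by nlinarith
    nlinarith [sq_nonneg a]
  have hb2 : b ≤ 0.1 := by linarith
  have e4 : r ≤ 1.2 * a * (u + 1) := by
    have h1 : b * u ≤ 1.045 * a * u := mul_le_mul_of_nonneg_right hb1 hu
    have h2 : b * r ≤ 0.1 * r := mul_le_mul_of_nonneg_right hb2 hr0
    nlinarith [mul_nonneg ha.le hu]
  have e5 : a * D * r ≤ 1.2 * (a * D) ^ 2 * (u + 1) := by
    have h1 : a * D * r ≤ a * D * (1.2 * a * (u + 1)) :=
      mul_le_mul_of_nonneg_left e4 (by positivity)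
    have h2 : a * (a * D) * (u+1) ≤ (a * D) * (a * D) * (u+1) := by
      have : a ≤ a * D := by nlinarith
      gcongr
    nlinarith
  have e6 : 1.2 * (a * D) ^ 2 * (u + 1) ≤ 1.2 * (a * D) ^ 2 * ((u ^ 2 + 1) / 2 + 1) := by
    gcongr
    nlinarith [sq_nonneg (u - 1)]
  nlinarith [mul_nonneg (sq_nonneg (a * D)) (sq_nonneg u), sq_nonneg (a*D)]

lemma aux_jac_quad {d : ℕ} (T : EuclideanSpace ℝ (Fin d) → EuclideanSpace ℝ (Fin d))
    (y v : EuclideanSpace ℝ (Fin d)) :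
    (v : Fin d → ℝ) ⬝ᵥ (jacMat T y).mulVec v = inner ℝ v (fderiv ℝ T y v) := by
  have hv : v = ∑ j, v j • EuclideanSpace.single j (1 : ℝ) := by
    have := (EuclideanSpace.basisFun (Fin d) ℝ).sum_repr v
    simpa using this.symm
  have h : ∀ i, (jacMat T y).mulVec v i = fderiv ℝ T y v i := by
    intro i
    conv_rhs => rw [hv]
    simp [Matrix.mulVec, dotProduct, jacMat, mul_comm]
  simp [dotProduct, h, PiLp.inner_apply, mul_comm]

lemma aux_hess_quad {d : ℕ} (U : EuclideanSpace ℝ (Fin d) → ℝ)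
    (y v : EuclideanSpace ℝ (Fin d)) :
    (v : Fin d → ℝ) ⬝ᵥ (hessMat U y).mulVec v = iteratedFDeriv ℝ 2 U y ![v, v] := by
  have hv : v = ∑ j, v j • EuclideanSpace.single j (1 : ℝ) := by
    have := (EuclideanSpace.basisFun (Fin d) ℝ).sum_repr v
    simpa using this.symm
  conv_rhs => rw [hv]
  simp [iteratedFDeriv_two_apply, Matrix.mulVec, dotProduct, hessMat,
    Finset.mul_sum, mul_comm, mul_left_comm]
  rw [Finset.sum_comm]
  refine Finset.sum_congr rfl fun i _ => Finset.sum_congr rfl fun j _ => by ring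

lemma aux_hess_bound {d : ℕ} (U : EuclideanSpace ℝ (Fin d) → ℝ) (L : ℝ)
    (y v w : EuclideanSpace ℝ (Fin d)) (h : ‖iteratedFDeriv ℝ 2 U y‖ ≤ L) :
    |iteratedFDeriv ℝ 2 U y ![v, w]| ≤ L * ‖v‖ * ‖w‖ := by
  have := (iteratedFDeriv ℝ 2 U y).le_of_opNorm_le h ![v, w]
  simpa [Fin.prod_univ_two, mul_assoc] using this

lemma aux_hess_symm {d : ℕ} (U : EuclideanSpace ℝ (Fin d) → ℝ) (hU : ContDiff ℝ 3 U)
    (y : EuclideanSpace ℝ (Fin d)) : (hessMat U y).IsSymm := by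
  ext i j
  have h : IsSymmSndFDerivAt ℝ U y :=
    hU.contDiffAt.isSymmSndFDerivAt (by simp [minSmoothness]; norm_num)
  simpa [hessMat, iteratedFDeriv_two_apply, Matrix.transpose_apply] using h _ _

lemma aux_lip {d : ℕ} {F : Type*} [NormedAddCommGroup F] [NormedSpace ℝ F]
    (f : EuclideanSpace ℝ (Fin d) → F) (hf : ContDiff ℝ 3 f) (C : ℝ)
    (h : ∀ z, ‖iteratedFDeriv ℝ 2 f z‖ ≤ C) (x y : EuclideanSpace ℝ (Fin d)) :
    ‖fderiv ℝ f y - fderiv ℝ f x‖ ≤ C * ‖y - x‖ := by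
  have hd : Differentiable ℝ (fderiv ℝ f) :=
    (hf.fderiv_right (m := 1) (by norm_num)).differentiable (by norm_num)
  refine Convex.norm_image_sub_le_of_norm_fderiv_le (s := Set.univ) (fun z _ => hd z) ?_
    convex_univ trivial trivial
  intro z _
  refine le_trans (le_of_eq ?_) (h z)
  have := norm_iteratedFDeriv_fderiv (𝕜 := ℝ) (f := f) (n := 1) (x := z)
  rw [← this, ← norm_iteratedFDeriv_fderiv (n := 0), norm_iteratedFDeriv_zero]

lemma aux_single {d : ℕ} (A : EuclideanSpace ℝ (Fin d) →L[ℝ] EuclideanSpace ℝ (Fin d))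
    (C : ℝ) (h : ‖A‖ ≤ C) (i : Fin d) : |A (EuclideanSpace.single i 1) i| ≤ C := by
  have h1 := PiLp.norm_apply_le (A (EuclideanSpace.single i 1)) i
  have h2 := A.le_of_opNorm_le h (EuclideanSpace.single i 1)
  simp at h1 h2
  linarith

theorem stmt15 {d : ℕ} (hd : 0 < d) (U : EuclideanSpace ℝ (Fin d) → ℝ)
    (L : ℝ) (hL : 0 < L) (hU : ContDiff ℝ 3 U)
    (hgrad0 : gradient U 0 = 0)
    (hHess : ∀ z, ‖iteratedFDeriv ℝ 2 U z‖ ≤ L)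
    (hD3U : ∀ z, ‖iteratedFDeriv ℝ 3 U z‖ ≤ L)
    (T : EuclideanSpace ℝ (Fin d) → EuclideanSpace ℝ (Fin d))
    (hT : ContDiff ℝ 3 T)
    (hJsymm : ∀ z, (jacMat T z).IsSymm)
    (hT0 : ∀ z, ‖T z‖ ≤ Real.sqrt L * (‖z‖ + 1))
    (hT1 : ∀ z, ‖fderiv ℝ T z‖ ≤ Real.sqrt L)
    (hT2 : ∀ z, ‖iteratedFDeriv ℝ 2 T z‖ ≤ Real.sqrt L)
    (hT3 : ∀ z, ‖iteratedFDeriv ℝ 3 T z‖ ≤ Real.sqrt L)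
    (δ : ℝ) (hδ0 : 0 < δ) (hδ : δ ≤ 1 / (2 ^ 8 * d ^ 2 * L))
    (x y : EuclideanSpace ℝ (Fin d))
    (hxy : x = y - δ • gradient U y + Real.sqrt (2 * δ) • T y) :
    IsUnit (1 - δ • hessMat U y + Real.sqrt (2 * δ) • jacMat T y) ∧
      |((1 - δ • hessMat U y + Real.sqrt (2 * δ) • jacMat T y).det)⁻¹ -
          (1 - Real.sqrt (2 * δ) * (jacMat T x).trace)| ≤
        8 * δ * (d : ℝ) ^ 2 * L * (‖x‖ ^ 2 + 1) := by
  classical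
  set M := 1 - δ • hessMat U y + Real.sqrt (2 * δ) • jacMat T y with hM
  have hMs : M.IsHermitian := by
    have h1 := aux_hess_symm U hU y
    have h2 := hJsymm y
    rw [Matrix.IsHermitian, Matrix.conjTranspose_eq_transpose_of_trivial]
    simp [hM, Matrix.transpose_add, Matrix.transpose_sub, Matrix.transpose_smul, h1.eq, h2.eq]
  set s := Real.sqrt (2 * δ) with hs
  have hs0 : 0 < s := Real.sqrt_pos.mpr (by linarith)
  have hs2 : s ^ 2 = 2 * δ := Real.sq_sqrt (by linarith)
  set q := Real.sqrt L with hq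
  have hq0 : 0 < q := Real.sqrt_pos.mpr hL
  have hq2 : q ^ 2 = L := Real.sq_sqrt hL.le
  obtain ⟨a, ha⟩ : ∃ a, a = s * q := ⟨_, rfl⟩
  have ha0 : 0 < a := ha ▸ mul_pos hs0 hq0
  have ha2 : a ^ 2 = 2 * δ * L := by rw [ha, mul_pow, hs2, hq2]
  obtain ⟨b, hb⟩ : ∃ b, b = a + a ^ 2 / 2 := ⟨_, rfl⟩
  have hbδ : b = δ * L + s * q := by rw [hb, ha2, ha]; ring
  have hD : (1 : ℝ) ≤ d := by exact_mod_cast hd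
  have hp : (a * d) ^ 2 ≤ 1 / 128 := by
    rw [mul_pow, ha2]
    rw [le_div_iff₀ (by positivity)] at hδ
    linarith
  have hb0 : 0 < b := by rw [hb]; positivity
  have hDb : d * b < 1 / 2 := by
    have hp' : a * d ≤ 0.09 := by
      by_contra h
      push Not at h
      nlinarith
    have ha' : a ≤ 0.09 := by nlinarith
    rw [hb]; nlinarith
  have hb1 : b < 1 := by nlinarith
  -- eigenvalues
  have heig : ∀ i, |hMs.eigenvalues i - 1| ≤ b := by
    intro i
    set v := hMs.eigenvectorBasis i with hv
    have hvn : ‖v‖ = 1 := hMs.eigenvectorBasis.orthonormal.1 i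
    have hmv := hMs.mulVec_eigenvectorBasis i
    have hvv : (v : Fin d → ℝ) ⬝ᵥ (v : Fin d → ℝ) = 1 := by
      have := real_inner_self_eq_norm_sq v
      rw [hvn, PiLp.inner_apply] at this
      simpa [dotProduct, pow_two] using this
    have hE : hMs.eigenvalues i - 1 =
        -(δ * iteratedFDeriv ℝ 2 U y ![v, v]) + s * inner ℝ v (fderiv ℝ T y v) := by
      have h1 : (v : Fin d → ℝ) ⬝ᵥ M.mulVec v = hMs.eigenvalues i := by
        rw [hmv]
        simp only [dotProduct_smul]
        rw [← hv, hvv]; simp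
      rw [← aux_hess_quad, ← aux_jac_quad, ← h1, hM]
      simp only [Matrix.add_mulVec, Matrix.sub_mulVec, Matrix.smul_mulVec, Matrix.one_mulVec,
        dotProduct_add, dotProduct_sub, dotProduct_smul, hvv, smul_eq_mul]
      ring
    have h1 := aux_hess_bound U L y v v (hHess y)
    have h2 : |inner ℝ v (fderiv ℝ T y v)| ≤ q := by
      refine (abs_real_inner_le_norm _ _).trans ?_
      have := (fderiv ℝ T y).le_of_opNorm_le (hT1 y) v
      rw [hvn] at this ⊢
      linarith
    rw [hvn] at h1
    rw [hE, hbδ]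
    refine (abs_add_le _ _).trans ?_
    rw [abs_neg, abs_mul, abs_mul, abs_of_pos hδ0, abs_of_pos hs0]
    gcongr
    linarith
  have hdet : M.det = ∏ i, (1 + (hMs.eigenvalues i - 1)) := by
    rw [hMs.det_eq_prod_eigenvalues]; simp
  have htr : M.trace - d = ∑ i, (hMs.eigenvalues i - 1) := by
    rw [hMs.trace_eq_sum_eigenvalues]; simp
  have hdet0 : M.det ≠ 0 := by
    rw [hdet]
    apply Finset.prod_ne_zero_iff.mpr
    intro i _
    have := (abs_le.mp (heig i)).1
    have : 0 < 1 + (hMs.eigenvalues i - 1) := by linarith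
    exact this.ne'
  refine ⟨(Matrix.isUnit_iff_isUnit_det _).mpr (isUnit_iff_ne_zero.mpr hdet0), ?_⟩
  have hmain := aux_prod2 (fun i => hMs.eigenvalues i - 1) b hb0.le hb1 (by simp; linarith) heig
  simp only [Fintype.card_fin] at hmain
  rw [← hdet, ← htr] at hmain
  have htr2 : M.trace - d = -(δ * (hessMat U y).trace) + s * (jacMat T y).trace := by
    rw [hM]
    simp [Matrix.trace_add, Matrix.trace_sub, Matrix.trace_smul]
    ring
  have hHtr : |δ * (hessMat U y).trace| ≤ a ^ 2 / 2 * d := by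
    rw [abs_mul, abs_of_pos hδ0, ha2]
    have : |(hessMat U y).trace| ≤ d * L := by
      refine (Finset.abs_sum_le_sum_abs _ _).trans ?_
      refine (Finset.sum_le_card_nsmul _ _ L ?_).trans (by simp)
      intro i _
      have := aux_hess_bound U L y (EuclideanSpace.single i 1) (EuclideanSpace.single i 1) (hHess y)
      simpa [hessMat] using this
    nlinarith
  have hTtr : |s * (jacMat T y).trace - s * (jacMat T x).trace| ≤ a * d * ‖y - x‖ := by
    rw [← mul_sub, abs_mul, abs_of_pos hs0, ← Matrix.trace_sub]
    have hl := aux_lip T hT q hT2 x y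
    have : |(jacMat T y - jacMat T x).trace| ≤ d * (q * ‖y - x‖) := by
      refine (Finset.abs_sum_le_sum_abs _ _).trans ?_
      refine (Finset.sum_le_card_nsmul _ _ (q * ‖y - x‖) ?_).trans (by simp)
      intro i _
      have := aux_single _ _ hl i
      simpa [jacMat] using this
    calc _ ≤ s * (d * (q * ‖y - x‖)) := by gcongr
      _ = _ := by rw [ha]; ring
  have hgrad : ‖gradient U y‖ ≤ L * ‖y‖ := by
    have hl := aux_lip U hU L hHess 0 y
    have h0 : fderiv ℝ U 0 = 0 := by
      simpa [gradient] using hgrad0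
    rw [h0] at hl
    simpa [gradient] using hl
  have hr : ‖y - x‖ ≤ b * (‖x‖ + ‖y - x‖) + a := by
    have e : y - x = δ • gradient U y - s • T y := by rw [hxy]; abel
    have h1 : ‖y - x‖ ≤ δ * (L * ‖y‖) + s * (q * (‖y‖ + 1)) := by
      rw [e]
      refine (norm_sub_le _ _).trans ?_
      rw [norm_smul, norm_smul, Real.norm_of_nonneg hδ0.le, Real.norm_of_nonneg hs0.le]
      gcongr
      exact hT0 y
    have h2 : ‖y‖ ≤ ‖x‖ + ‖y - x‖ := by
      have := norm_add_le x (y - x)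
      simpa using this
    calc _ ≤ _ := h1
      _ = b * ‖y‖ + a := by rw [hbδ, ha]; ring
      _ ≤ _ := by gcongr
  have := aux_final d a b ‖x‖ ‖y - x‖ |M.det⁻¹ - (1 - s * (jacMat T x).trace)| hD ha0 hp hb
    (norm_nonneg _) (norm_nonneg _) hr (by
      have e : M.det⁻¹ - (1 - s * (jacMat T x).trace) =
        (M.det⁻¹ - 1 + (M.trace - d)) + δ * (hessMat U y).trace +
          (-(s * (jacMat T y).trace - s * (jacMat T x).trace)) := by rw [htr2]; ring
      rw [e]
      refine (abs_add_three _ _ _).trans ?_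
      rw [abs_neg]
      linarith)
  rw [ha2] at this
  linarith
end
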